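/- Let 0 ≤ ρ ≤ 1 and fix constants r, L, C > 0. Let Λ_n be a sequence of (r,L)-Lipschitz bounded open subsets of ℝ³ such that B(0, ℓ_n/C) ⊂ Λ_n ⊂ B(0, ℓ_n) for some sequence ℓ_n → ∞, and satisfying the Fisher regularity condition |∂Λ_n + B(0,h)| ≤ C ℓ_n² h for all 0 < h ≤ ℓ_n. Then the limit e(ρ) := lim_{n→∞} E_{Λ_n}(ρ)/|Λ_n| exists, and its value is the same for every sequence Λ_n satisfying these hypotheses (in particular it does not depend on r, L, C or on the sequence ℓ_n). -/

import Mathlib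

open MeasureTheory Metric Set Filter Bornology
open scoped Topology ENNReal NNReal Pointwise

noncomputable section

/-- Three-dimensional Euclidean space. -/
abbrev E3 : Type := EuclideanSpace ℝ (Fin 3)

/-- The divergence of a vector field on `E3`, defined as the trace of its derivative. -/
def divg (φ : E3 → E3) (x : E3) : ℝ :=
  LinearMap.trace ℝ E3 (fderiv ℝ φ x : E3 →ₗ[ℝ] E3)

/-- The candidate values `∫_Ω div φ` over `C¹` compactly supported vector fields bounded by one. -/
def perCand (Ω : Set E3) : Set ℝ :=
  {a : ℝ | ∃ φ : E3 → E3, ContDiff ℝ 1 φ ∧ HasCompactSupport φ ∧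
      (∀ x, ‖φ x‖ ≤ 1) ∧ a = ∫ x in Ω, divg φ x}

/-- The perimeter of a set, in the sense of geometric measure theory. -/
def per (Ω : Set E3) : ℝ := sSup (perCand Ω)

/-- A set has finite perimeter if the family of integrals defining the perimeter is
bounded above. -/
def HasFinPer (Ω : Set E3) : Prop := BddAbove (perCand Ω)

/-- The Lebesgue volume of a set as a real number. -/
def vol (Ω : Set E3) : ℝ := (volume Ω).toReal

/-- The liquid drop energy `𝓔_Λ[ρ,Ω]`. -/
def ldEnergy (Λ : Set E3) (ρ : ℝ) (Ω : Set E3) : ℝ :=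
  per Ω + (1/2) * ∫ x, ∫ y,
    (Set.indicator Ω (fun _ => (1:ℝ)) x - ρ * Set.indicator Λ (fun _ => (1:ℝ)) x) *
      (Set.indicator Ω (fun _ => (1:ℝ)) y - ρ * Set.indicator Λ (fun _ => (1:ℝ)) y) / ‖x - y‖

/-- The neutral ground state energy `E_Λ(ρ)`. -/
def EE (Λ : Set E3) (ρ : ℝ) : ℝ :=
  sInf {t : ℝ | ∃ Ω : Set E3, MeasurableSet Ω ∧ Ω ⊆ Λ ∧ HasFinPer Ω ∧
    vol Ω = ρ * vol Λ ∧ t = ldEnergy Λ ρ Ω}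

/-- The liquid drop energy `I[Ω]` of an isolated droplet (no background). -/
def II (Ω : Set E3) : ℝ :=
  per Ω + (1/2) * ∫ x in Ω, ∫ y in Ω, 1 / ‖x - y‖

/-- `μ* = inf I[Ω]/|Ω|`. -/
def muStar : ℝ :=
  sInf {t : ℝ | ∃ Ω : Set E3, MeasurableSet Ω ∧ HasFinPer Ω ∧
    0 < volume Ω ∧ volume Ω < ⊤ ∧ t = II Ω / vol Ω}

/-- A minimizer for the isolated liquid drop problem. -/
def IsMinimizer (Ω : Set E3) : Prop :=
  MeasurableSet Ω ∧ HasFinPer Ω ∧ 0 < volume Ω ∧ volume Ω < ⊤ ∧ II Ω = muStar * vol Ω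

/-- The set of masses of minimizers. -/
def minimizerMasses : Set ℝ := {m : ℝ | ∃ Ω : Set E3, IsMinimizer Ω ∧ m = vol Ω}

/-- The largest mass of a minimizer. -/
def mStar : ℝ := sSup minimizerMasses

/-- The smallest mass of a minimizer. -/
def mStarStar : ℝ := sInf minimizerMasses

/-- `Λ` is an `(r,L)`-Lipschitz open set: near each boundary point it is, in a suitable
orthonormal coordinate system, the epigraph of an `L`-Lipschitz function. -/
def IsLipschitzDomain (r L : ℝ) (Λ : Set E3) : Prop :=
  ∀ x ∈ frontier Λ, ∃ (g : E3 ≃ᵢ E3) (f : ℝ × ℝ → ℝ),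
    LipschitzWith L.toNNReal f ∧
    Λ ∩ ball x r = {y ∈ ball x r | f (g y 0, g y 1) < g y 2}

/-- Fisher regularity of the boundary. -/
def FisherCond (C ℓ : ℝ) (Λ : Set E3) : Prop :=
  ∀ h : ℝ, 0 < h → h ≤ ℓ → (volume (frontier Λ + ball (0:E3) h)).toReal ≤ C * ℓ^2 * h

/-- An admissible sequence of domains for the thermodynamic limit. -/
def IsAdmissibleSeq (r L C : ℝ) (Λs : ℕ → Set E3) (ℓ : ℕ → ℝ) : Prop :=
  Tendsto ℓ atTop atTop ∧
  ∀ n : ℕ, IsOpen (Λs n) ∧ IsBounded (Λs n) ∧ IsLipschitzDomain r L (Λs n) ∧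
    ball 0 (ℓ n / C) ⊆ Λs n ∧ Λs n ⊆ ball 0 (ℓ n) ∧ FisherCond C (ℓ n) (Λs n)

/-- `e` is the thermodynamic limit function of the liquid drop model. -/
def IsThermoLimit (e : ℝ → ℝ) : Prop :=
  ∀ ρ : ℝ, 0 ≤ ρ → ρ ≤ 1 →
    ∀ (r L C : ℝ) (Λs : ℕ → Set E3) (ℓ : ℕ → ℝ), 0 < r → 0 < L → 0 < C →
      IsAdmissibleSeq r L C Λs ℓ →
      Tendsto (fun n => EE (Λs n) ρ / vol (Λs n)) atTop (𝓝 (e ρ))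

/-- The domain for the `N`-particle Jellium problem: `N^{1/3} Λ₁` with `Λ₁` the ball of
unit volume centered at the origin. -/
def jelDomain (N : ℕ) : Set E3 :=
  ball (0:E3) ((N : ℝ) ^ ((1:ℝ)/3) * (3 / (4 * Real.pi)) ^ ((1:ℝ)/3))

/-- The `N`-particle Jellium ground state energy. -/
def jelN (N : ℕ) : ℝ :=
  sInf {t : ℝ | ∃ x : Fin N → E3, (∀ j, x j ∈ jelDomain N) ∧
    t = (∑ j : Fin N, ∑ k : Fin N, if j < k then 1 / ‖x j - x k‖ else 0)
      - (∑ j : Fin N, ∫ y in jelDomain N, 1 / ‖x j - y‖)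
      + (1/2) * ∫ x' in jelDomain N, ∫ y in jelDomain N, 1 / ‖x' - y‖}

/-- `eJ` is the Jellium energy per particle in the thermodynamic limit. -/
def IsJelliumLimit (eJ : ℝ) : Prop :=
  Tendsto (fun N : ℕ => jelN N / (N : ℝ)) atTop (𝓝 eJ)

/-- The grand-canonical liquid drop energy `F_Λ(ρ)`. -/
def FF (Λ : Set E3) (ρ : ℝ) : ℝ :=
  sInf {t : ℝ | ∃ Ω : Set E3, MeasurableSet Ω ∧ Ω ⊆ Λ ∧ HasFinPer Ω ∧
    t = ldEnergy Λ ρ Ω - muStar * vol Ω}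

/-- A tetrahedron: the interior of the convex hull of four affinely independent points. -/
def IsTetra (Δ : Set E3) : Prop :=
  ∃ v : Fin 4 → E3, AffineIndependent ℝ v ∧ Δ = interior (convexHull ℝ (Set.range v))

/-- The open cube `(-L/2, L/2)³`. -/
def cubeL (Lside : ℝ) : Set E3 := {x : E3 | ∀ i, |x i| < Lside / 2}

/-- The grand-canonical Jellium energy of point particles of charge `m` in the domain `S`
with a uniform background of density one. -/
def pointJellium (m : ℝ) (S : Set E3) : ℝ :=
  sInf {t : ℝ | ∃ (n : ℕ) (x : Fin n → E3), (∀ j, x j ∈ S) ∧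
    t = (∑ j : Fin n, ∑ k : Fin n, if j < k then m^2 / ‖x j - x k‖ else 0)
      - m * (∑ j : Fin n, ∫ y in S, 1 / ‖x j - y‖)
      + (1/2) * ∫ x' in S, ∫ y in S, 1 / ‖x' - y‖}

/-- The conclusions of the decomposition theorem for minimizing sequences. -/
def IsDecomp (Ω : ℕ → Set E3) (m : ℝ) (K : ℕ) (Ωs : Fin K → Set E3)
    (a : ℕ → Fin K → E3) (R : ℝ) (φ : ℕ → ℕ) : Prop :=
  StrictMono φ ∧ 0 < R ∧
  (∀ j k : Fin K, j ≠ k → Tendsto (fun n => ‖a n j - a n k‖) atTop atTop) ∧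
  (∀ j, IsMinimizer (Ωs j)) ∧
  (∀ j, mStarStar ≤ vol (Ωs j) ∧ vol (Ωs j) ≤ mStar) ∧
  (∀ j, Tendsto
    (fun n => volume (symmDiff ({x : E3 | x + a n j ∈ Ω (φ n)} ∩ ball (0:E3) R) (Ωs j)))
    atTop (𝓝 0)) ∧
  Tendsto (fun n => volume (Ω (φ n) \ ⋃ j, ball (a n j) R)) atTop (𝓝 0) ∧
  Tendsto (fun n => per (Ω (φ n) \ ⋃ j, ball (a n j) R)) atTop (𝓝 0) ∧
  m = ∑ j, vol (Ωs j) ∧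
  (2 ≤ K → ∃ ε : ℕ → ℝ, Tendsto ε atTop (𝓝 0) ∧ ∀ n : ℕ,
    muStar * vol (Ω (φ n)) +
      (∑ j : Fin K, ∑ k : Fin K,
        if j < k then (vol (Ωs j) * vol (Ωs k) + ε n) / ‖a n j - a n k‖ else 0)
      ≤ II (Ω (φ n)))

instance : MeasurableSpace (Matrix (Fin 3) (Fin 3) ℝ) :=
  (inferInstance : MeasurableSpace (Fin 3 → Fin 3 → ℝ))

/-- The rotation group SO(3), as a set of matrices. -/
def SO3 : Set (Matrix (Fin 3) (Fin 3) ℝ) := {R | R * R.transpose = 1 ∧ R.det = 1}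

/-- The action of a matrix on Euclidean space. -/
def rot (R : Matrix (Fin 3) (Fin 3) ℝ) (x : E3) : E3 :=
  (EuclideanSpace.equiv (Fin 3) ℝ).symm (R.mulVec (EuclideanSpace.equiv (Fin 3) ℝ x))

/-- The image of a set under the rigid motion `x ↦ Rx + τ`. -/
def rigidImage (R : Matrix (Fin 3) (Fin 3) ℝ) (τ : E3) (S : Set E3) : Set E3 :=
  (fun x => rot R x + τ) '' S

/-- `μ` is the normalized Haar measure of SO(3): a probability measure concentrated on SO(3)
which is invariant under left multiplication by rotations. -/
def IsHaarSO3 (μ : Measure (Matrix (Fin 3) (Fin 3) ℝ)) : Prop :=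
  IsProbabilityMeasure μ ∧ μ SO3ᶜ = 0 ∧ ∀ S ∈ SO3, Measure.map (fun R => S * R) μ = μ

/-- The cube of the tiling of side length `ε` indexed by `z ∈ ℤ³`. -/
def cubeZ (ε : ℝ) (z : Fin 3 → ℤ) : Set E3 := {x : E3 | ∀ i, |x i - ε * (z i : ℝ)| < ε / 2}

/-- The distance between two sets. -/
def setDist (s t : Set E3) : ℝ := sInf {d : ℝ | ∃ p ∈ s, ∃ q ∈ t, d = dist p q}

/-- The outer cubic boundary layer of `Λ` at scale `ε`. -/
def outerLayer (Λ : Set E3) (ε : ℝ) : Set E3 :=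
  ⋃ z ∈ {z : Fin 3 → ℤ | setDist (cubeZ ε z) (frontier Λ) ≤ ε}, closure (cubeZ ε z \ Λ)

/-- Bounded measurable functions with bounded support. -/
def Nice (f : E3 → ℝ) : Prop :=
  Measurable f ∧ ∃ M : ℝ, 0 < M ∧ (∀ x, |f x| ≤ M) ∧ ∀ x, M ≤ ‖x‖ → f x = 0

/-- The Coulomb bilinear form. -/
def BB (f g : E3 → ℝ) : ℝ := ∫ x, ∫ y, f x * g y / ‖x - y‖

/-- The charge density. -/
def chg (ρ : ℝ) (Λ Ω : Set E3) : E3 → ℝ := fun x =>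
  Set.indicator Ω (fun _ => (1:ℝ)) x - ρ * Set.indicator Λ (fun _ => (1:ℝ)) x

/-- The Coulomb potential. -/
def pot (g : E3 → ℝ) (x : E3) : ℝ := ∫ y, g y / ‖x - y‖

theorem ldEnergy_eq (Λ : Set E3) (ρ : ℝ) (Ω : Set E3) :
    ldEnergy Λ ρ Ω = per Ω + (1/2) * BB (chg ρ Λ Ω) (chg ρ Λ Ω) := rfl

theorem Nice.add {f g : E3 → ℝ} (hf : Nice f) (hg : Nice g) : Nice (fun x => f x + g x) := by
  obtain ⟨mf, M, hM, h1, h2⟩ := hf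
  obtain ⟨mg, N, hN, h3, h4⟩ := hg
  refine ⟨mf.add mg, M + N, by positivity, fun x => ?_, fun x hx => ?_⟩
  · exact (abs_add_le _ _).trans (add_le_add (h1 x) (h3 x))
  · show f x + g x = 0
    rw [h2 x (by linarith), h4 x (by linarith), add_zero]

theorem Nice.const_mul {f : E3 → ℝ} (hf : Nice f) (c : ℝ) : Nice (fun x => c * f x) := by
  obtain ⟨mf, M, hM, h1, h2⟩ := hf
  refine ⟨mf.const_mul c, (|c| + 1) * M, by positivity, fun x => ?_, fun x hx => ?_⟩
  · rw [abs_mul]; nlinarith [h1 x, abs_nonneg c, abs_nonneg (f x)]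
  · show c * f x = 0
    rw [h2 x (by nlinarith [abs_nonneg c]), mul_zero]

theorem nice_zero : Nice (fun _ => (0:ℝ)) :=
  ⟨measurable_const, 1, one_pos, fun x => by simp, fun x _ => rfl⟩

theorem nice_indicator {A : Set E3} (hA : MeasurableSet A) (hb : IsBounded A) :
    Nice (Set.indicator A (fun _ => (1:ℝ))) := by
  obtain ⟨R, hR, h⟩ := hb.exists_pos_norm_lt
  refine ⟨measurable_const.indicator hA, R + 1, by positivity, fun x => ?_, fun x hx => ?_⟩
  · by_cases hx : x ∈ A <;> simp [hx] <;> linarith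
  · apply Set.indicator_of_notMem
    intro hxA
    have := h x hxA
    linarith

theorem nice_chg {A B : Set E3} (ρ : ℝ) (hA : MeasurableSet A) (hB : MeasurableSet B)
    (hAB : B ⊆ A) (hb : IsBounded A) : Nice (chg ρ A B) := by
  have h := (nice_indicator hB (hb.subset hAB)).add ((nice_indicator hA hb).const_mul (-ρ))
  convert h using 2
  simp [chg, sub_eq_add_neg]

theorem integrableOn_inv_norm (R : ℝ) :
    IntegrableOn (fun y : E3 => 1 / ‖y‖) (ball (0:E3) R) := by
  have := (integrableOn_fun_norm_addHaar (E := E3) volume (f := fun t : ℝ => 1 / t) (r := R)).2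
  apply this
  have h2 : IntegrableOn (fun y : ℝ => y) (Ioo 0 R) :=
    (continuous_id.integrableOn_Icc (a := 0) (b := R)).mono_set Ioo_subset_Icc_self
  refine h2.congr_fun (fun y hy => ?_) measurableSet_Ioo
  have hy0 : y ≠ 0 := hy.1.ne'
  simp only [finrank_euclideanSpace, Fintype.card_fin, smul_eq_mul]
  field_simp

theorem Nice.integrable {f : E3 → ℝ} (hf : Nice f) : Integrable f := by
  obtain ⟨mf, M, hM, h1, h2⟩ := hf
  have hs : Function.support f ⊆ ball (0:E3) M := by
    intro x hx
    by_contra h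
    exact hx (h2 x (by simpa using h))
  rw [← integrableOn_iff_integrable_of_support_subset hs]
  exact Measure.integrableOn_of_bounded (M := M) measure_ball_lt_top.ne
    mf.aestronglyMeasurable (ae_of_all _ h1)

theorem integrable_kernel {f g : E3 → ℝ} (hf : Nice f) (hg : Nice g) :
    Integrable (fun p : E3 × E3 => f p.1 * g p.2 / ‖p.1 - p.2‖) (volume.prod volume) := by
  obtain ⟨mf, M, hM, h1, h2⟩ := hf
  obtain ⟨mg, N, hN, h3, h4⟩ := hg
  have hk : Integrable (fun p : E3 × E3 =>
      ((ball (0:E3) M).indicator (fun _ => M) p.1) *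
      ((ball (0:E3) (M+N)).indicator (fun y => N * (1 / ‖y‖)) p.2)) (volume.prod volume) := by
    apply Integrable.mul_prod
    · rw [integrable_indicator_iff measurableSet_ball]
      exact integrableOn_const measure_ball_lt_top.ne
    · rw [integrable_indicator_iff measurableSet_ball]
      exact (integrableOn_inv_norm _).const_mul N
  have hmp := (measurePreserving_prod_neg_add (volume : Measure E3) (volume : Measure E3))
  have hk2 := hmp.integrable_comp_of_integrable hk
  refine hk2.mono' ?_ (ae_of_all _ fun p => ?_)
  · exact (((mf.comp measurable_fst).mul (mg.comp measurable_snd)).div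
      (measurable_fst.sub measurable_snd).norm).aestronglyMeasurable
  · rcases p with ⟨x, y⟩
    simp only [Function.comp]
    by_cases hx : x ∈ ball (0:E3) M
    · by_cases hy : y ∈ ball (0:E3) N
      · have : -x + y ∈ ball (0:E3) (M+N) := by
          simp only [mem_ball_zero_iff] at *
          exact (norm_add_le _ _).trans_lt (by rw [norm_neg]; linarith)
        rw [indicator_of_mem hx, indicator_of_mem this]
        rw [Real.norm_eq_abs, abs_div, abs_mul, abs_norm, neg_add_eq_sub, norm_sub_rev y x,
          ← mul_assoc, mul_one_div]
        gcongr
        · exact h1 x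
        · exact h3 y
      · rw [h4 y (by simpa using hy)]
        simp only [mul_zero, zero_div, norm_zero]
        apply mul_nonneg
        · exact indicator_nonneg (fun _ _ => hM.le) _
        · exact indicator_nonneg (fun _ _ => by positivity) _
    · rw [h2 x (by simpa using hx)]
      simp only [zero_mul, zero_div, norm_zero]
      apply mul_nonneg
      · exact indicator_nonneg (fun _ _ => hM.le) _
      · exact indicator_nonneg (fun _ _ => by positivity) _

theorem BB_eq_prod {f g : E3 → ℝ} (hf : Nice f) (hg : Nice g) :
    BB f g = ∫ p : E3 × E3, f p.1 * g p.2 / ‖p.1 - p.2‖ ∂(volume.prod volume) :=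
  (integral_prod _ (integrable_kernel hf hg)).symm

theorem BB_symm {f g : E3 → ℝ} (hf : Nice f) (hg : Nice g) : BB f g = BB g f := by
  rw [BB_eq_prod hf hg, BB_eq_prod hg hf, ← integral_prod_swap]
  congr 1
  ext p
  simp [norm_sub_rev, mul_comm]

theorem BB_add_left {f f' g : E3 → ℝ} (hf : Nice f) (hf' : Nice f') (hg : Nice g) :
    BB (fun x => f x + f' x) g = BB f g + BB f' g := by
  rw [BB_eq_prod hf hg, BB_eq_prod hf' hg, BB_eq_prod (hf.add hf') hg,
    ← integral_add (integrable_kernel hf hg) (integrable_kernel hf' hg)]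
  congr 1
  ext p
  ring

theorem BB_add_right {f g g' : E3 → ℝ} (hf : Nice f) (hg : Nice g) (hg' : Nice g') :
    BB f (fun x => g x + g' x) = BB f g + BB f g' := by
  rw [BB_symm hf (hg.add hg'), BB_add_left hg hg' hf, BB_symm hg hf, BB_symm hg' hf]

theorem BB_add_add {f g : E3 → ℝ} (hf : Nice f) (hg : Nice g) :
    BB (fun x => f x + g x) (fun x => f x + g x) = BB f f + 2 * BB f g + BB g g := by
  rw [BB_add_left hf hg (hf.add hg), BB_add_right hf hf hg, BB_add_right hg hf hg, BB_symm hg hf]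
  ring

theorem BB_zero_left (g : E3 → ℝ) : BB (fun _ => 0) g = 0 := by simp [BB]

theorem BB_eq_pot (f g : E3 → ℝ) : BB f g = ∫ x, f x * pot g x := by
  unfold BB pot
  congr 1
  ext x
  rw [← integral_const_mul]
  congr 1
  ext y
  ring

theorem integrable_mul_pot {f g : E3 → ℝ} (hf : Nice f) (hg : Nice g) :
    Integrable (fun x => f x * pot g x) := by
  have := (integrable_kernel hf hg).integral_prod_left
  refine this.congr (ae_of_all _ fun x => ?_)
  simp only [pot]
  rw [← integral_const_mul]
  congr 1
  ext y
  ring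

theorem ae_ne_prod : ∀ᵐ p : E3 × E3 ∂(volume.prod volume), p.1 ≠ p.2 := by
  have hm : MeasurableSet {p : E3 × E3 | p.1 = p.2} := measurableSet_diagonal
  have : (volume.prod volume : Measure (E3 × E3)) {p : E3 × E3 | p.1 = p.2} = 0 := by
    rw [Measure.measure_prod_null hm]
    refine ae_of_all _ fun x => ?_
    have : Prod.mk x ⁻¹' {p : E3 × E3 | p.1 = p.2} = {x} := by
      ext y; simp [eq_comm]
    show volume (Prod.mk x ⁻¹' {p : E3 × E3 | p.1 = p.2}) = 0
    rw [this]; simp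
  rw [ae_iff]
  simpa using this

theorem integrable_gauss {b : ℝ} (hb : 0 < b) :
    Integrable (fun z : E3 => Real.exp (-b * ‖z‖^2)) := by
  by_contra h
  have h1 := GaussianFourier.integral_rexp_neg_mul_sq_norm (V := E3) hb
  rw [integral_undef h] at h1
  have : 0 < (Real.pi / b) ^ ((Module.finrank ℝ E3 : ℝ) / 2) := by positivity
  linarith

theorem gauss_para (x y z : E3) :
    2 * ‖x - z‖^2 + 2 * ‖y - z‖^2 = ‖x - y‖^2 + 4 * ‖z - (1/2 : ℝ) • (x + y)‖^2 := by
  have h := parallelogram_law_with_norm ℝ (x - z) (y - z)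
  have e1 : x - z - (y - z) = x - y := by abel
  have e2 : x - z + (y - z) = (-2 : ℝ) • (z - (1/2 : ℝ) • (x + y)) := by
    rw [smul_sub, smul_smul]; norm_num; rw [two_smul]; abel
  rw [e1, e2, norm_smul] at h
  norm_num at h
  norm_num
  nlinarith [h]

theorem gauss_psd {f : E3 → ℝ} (hf : Nice f) {b : ℝ} (hb : 0 < b) :
    0 ≤ ∫ p : E3 × E3, f p.1 * f p.2 * Real.exp (-b * ‖p.1 - p.2‖^2) ∂(volume.prod volume) := by
  set G : E3 × E3 → E3 → ℝ := fun p z => f p.1 * f p.2 *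
    (Real.exp (-(2*b) * ‖p.1 - z‖^2) * Real.exp (-(2*b) * ‖p.2 - z‖^2)) with hG
  have mf := hf.1
  have key : ∀ (p : E3 × E3) (z : E3),
      G p z = f p.1 * f p.2 * Real.exp (-b * ‖p.1 - p.2‖^2) *
        Real.exp (-(4*b) * ‖z - (1/2 : ℝ) • (p.1 + p.2)‖^2) := by
    intro p z
    simp only [hG]
    rw [← Real.exp_add, mul_assoc _ (Real.exp _) (Real.exp _), ← Real.exp_add]
    congr 2
    linear_combination (-b) * gauss_para p.1 p.2 z
  set C : ℝ := ∫ z : E3, Real.exp (-(4*b) * ‖z‖^2) with hC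
  have hCpos : 0 < C := by
    rw [hC, GaussianFourier.integral_rexp_neg_mul_sq_norm (V := E3) (by linarith)]
    positivity
  have hshift : ∀ p : E3 × E3,
      ∫ z : E3, Real.exp (-(4*b) * ‖z - (1/2 : ℝ) • (p.1 + p.2)‖^2) = C := fun p =>
    integral_sub_right_eq_self (fun z : E3 => Real.exp (-(4*b) * ‖z‖^2)) _
  have hIntg : Integrable (Function.uncurry G) ((volume.prod volume).prod volume) := by
    rw [integrable_prod_iff]
    · constructor
      · refine ae_of_all _ fun p => ?_
        simp only [Function.uncurry]
        simp_rw [key]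
        exact ((integrable_gauss (by linarith)).comp_sub_right _).const_mul _
      · have : Integrable (fun p : E3 × E3 => |f p.1| * |f p.2|) (volume.prod volume) :=
          hf.integrable.abs.mul_prod hf.integrable.abs
        refine (this.mul_const C).mono' ?_ (ae_of_all _ fun p => ?_)
        · refine (AEStronglyMeasurable.norm ?_).integral_prod_right'
          refine Measurable.aestronglyMeasurable ?_
          simp only [hG, Function.uncurry_def]
          fun_prop
        · simp only [Function.uncurry]
          simp_rw [key, norm_mul, Real.norm_eq_abs, Real.abs_exp]
          rw [integral_const_mul, hshift, abs_mul, abs_mul, abs_mul, abs_abs, abs_abs, Real.abs_exp,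
            abs_of_pos hCpos]
          have h1 : Real.exp (-b * ‖p.1 - p.2‖^2) ≤ 1 := by
            apply Real.exp_le_one_iff.2
            nlinarith [sq_nonneg ‖p.1 - p.2‖]
          have : 0 ≤ |f p.1| * |f p.2| := by positivity
          exact mul_le_mul_of_nonneg_right (mul_le_of_le_one_right this h1) hCpos.le
    · refine Measurable.aestronglyMeasurable ?_
      simp only [hG, Function.uncurry_def]
      fun_prop
  have h1 : (∫ p : E3 × E3, ∫ z, G p z ∂volume ∂(volume.prod volume)) =
      C * ∫ p : E3 × E3, f p.1 * f p.2 * Real.exp (-b * ‖p.1 - p.2‖^2) ∂(volume.prod volume) := by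
    rw [← integral_const_mul]
    congr 1
    ext p
    simp_rw [key]
    rw [integral_const_mul, hshift, mul_comm]
  have h2 : (∫ p : E3 × E3, ∫ z, G p z ∂volume ∂(volume.prod volume)) =
      ∫ z : E3, (∫ x, f x * Real.exp (-(2*b) * ‖x - z‖^2)) ^ 2 := by
    rw [integral_integral_swap hIntg]
    congr 1
    ext z
    rw [sq, ← integral_prod_mul]
    congr 1
    ext p
    simp only [hG]
    ring
  have h3 : 0 ≤ C * ∫ p : E3 × E3, f p.1 * f p.2 * Real.exp (-b * ‖p.1 - p.2‖^2)
      ∂(volume.prod volume) := by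
    rw [← h1, h2]
    exact integral_nonneg fun z => sq_nonneg _
  exact nonneg_of_mul_nonneg_right h3 hCpos

theorem BB_self_nonneg {f : E3 → ℝ} (hf : Nice f) : 0 ≤ BB f f := by
  have mf := hf.1
  set G : E3 × E3 → ℝ → ℝ := fun p t => f p.1 * f p.2 *
    Real.exp (-(‖p.1 - p.2‖^2) * t^2) with hG
  have hgi : ∀ p : E3 × E3, ∫ t : ℝ, Real.exp (-(‖p.1 - p.2‖^2) * t^2)
      = √Real.pi / ‖p.1 - p.2‖ := by
    intro p
    rw [integral_gaussian, Real.sqrt_div' _ (by positivity), Real.sqrt_sq (norm_nonneg _)]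
  have hIntg : Integrable (Function.uncurry G) ((volume.prod volume).prod volume) := by
    rw [integrable_prod_iff]
    · constructor
      · filter_upwards [ae_ne_prod] with p hp
        simp only [Function.uncurry, hG]
        refine (integrable_exp_neg_mul_sq ?_).const_mul _
        have : p.1 - p.2 ≠ 0 := sub_ne_zero.2 hp
        positivity
      · refine ((integrable_kernel hf hf).norm.const_mul (√Real.pi)).congr (ae_of_all _ fun p => ?_)
        simp only [Function.uncurry, hG]
        simp_rw [norm_mul, Real.norm_eq_abs, Real.abs_exp]
        rw [integral_const_mul, hgi, abs_div, abs_mul, abs_norm]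
        ring
    · refine Measurable.aestronglyMeasurable ?_
      simp only [hG, Function.uncurry_def]
      fun_prop
  have h1 : (∫ p : E3 × E3, ∫ t, G p t ∂volume ∂(volume.prod volume)) = √Real.pi * BB f f := by
    rw [BB_eq_prod hf hf, ← integral_const_mul]
    congr 1
    ext p
    simp only [hG]
    rw [integral_const_mul, hgi]
    ring
  have h2 : 0 ≤ (∫ p : E3 × E3, ∫ t, G p t ∂volume ∂(volume.prod volume)) := by
    rw [integral_integral_swap hIntg]
    apply integral_nonneg_of_ae
    have h0 : ∀ᵐ t : ℝ, t ≠ 0 := by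
      rw [ae_iff]; simp
    filter_upwards [h0] with t ht
    have := gauss_psd hf (b := t^2) (by positivity)
    simp only [hG, Pi.zero_apply]
    refine this.trans_eq (integral_congr_ae (ae_of_all _ fun p => ?_))
    beta_reduce
    rw [show -t^2 * ‖p.1 - p.2‖^2 = -(‖p.1 - p.2‖^2) * t^2 by ring]
  rw [h1] at h2
  exact nonneg_of_mul_nonneg_right h2 (by positivity)

/-- Uniform bound on potentials. -/
def potC : ℝ := ∫ y in ball (0:E3) 1, 1 / ‖y‖

theorem potC_nonneg : 0 ≤ potC := integral_nonneg fun y => by positivity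

theorem pot_le {g : E3 → ℝ} {S : Set E3} (hS : MeasurableSet S)
    (hSf : volume S ≠ ⊤) {M : ℝ} (hM : 0 ≤ M) (h1 : ∀ x, |g x| ≤ M) (h2 : ∀ x, x ∉ S → g x = 0)
    (x : E3) : |pot g x| ≤ M * (potC + vol S) := by
  have hi1 : Integrable (fun y => (ball (0:E3) 1).indicator (fun y => 1 / ‖y‖) (x - y)) := by
    apply Integrable.comp_sub_left
      (f := (ball (0:E3) 1).indicator (fun y => 1 / ‖y‖))
    rw [integrable_indicator_iff measurableSet_ball]
    exact integrableOn_inv_norm 1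
  have hi2 : Integrable (S.indicator (fun _ => (1:ℝ))) := by
    rw [integrable_indicator_iff hS]
    exact integrableOn_const hSf
  have e1 : ∫ y, (ball (0:E3) 1).indicator (fun y => 1 / ‖y‖) (x - y) = potC := by
    rw [integral_sub_left_eq_self (fun y => (ball (0:E3) 1).indicator (fun y => 1 / ‖y‖) y) volume x,
      integral_indicator measurableSet_ball, potC]
  have e2 : ∫ y, S.indicator (fun _ => (1:ℝ)) y = vol S := by
    rw [integral_indicator hS]; simp [vol, Measure.real]
  rw [← e1, ← e2, ← integral_add hi1 hi2, ← integral_const_mul, ← Real.norm_eq_abs]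
  refine norm_integral_le_of_norm_le ((hi1.add hi2).const_mul M) (ae_of_all _ fun y => ?_)
  by_cases hy : y ∈ S
  · rw [indicator_of_mem hy, Real.norm_eq_abs, abs_div, abs_norm, div_eq_mul_one_div]
    have hk : 1 / ‖x - y‖ ≤ (ball (0:E3) 1).indicator (fun y => 1 / ‖y‖) (x - y) + 1 := by
      by_cases hb : x - y ∈ ball (0:E3) 1
      · rw [indicator_of_mem hb]; linarith
      · rw [indicator_of_notMem hb, zero_add]
        simp only [mem_ball_zero_iff, not_lt] at hb
        rw [div_le_one (by linarith)]; exact hb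
    exact mul_le_mul (h1 y) hk (by positivity) hM
  · rw [h2 y hy]
    simp only [zero_div, norm_zero]
    apply mul_nonneg hM
    apply add_nonneg
    · exact indicator_nonneg (fun _ _ => by positivity) _
    · exact indicator_nonneg (fun _ _ => by positivity) _

theorem BB_self_le {f : E3 → ℝ} {S : Set E3} (hS : MeasurableSet S)
    (hSf : volume S ≠ ⊤) (h1 : ∀ x, |f x| ≤ 1) (h2 : ∀ x, x ∉ S → f x = 0) :
    BB f f ≤ vol S * (potC + vol S) := by
  rw [BB_eq_pot]
  have e2 : ∫ y, S.indicator (fun _ => (potC + vol S)) y = vol S * (potC + vol S) := by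
    rw [integral_indicator hS]; simp [vol, Measure.real]
  rw [← e2]
  have hi2 : Integrable (S.indicator (fun _ => (potC + vol S))) := by
    rw [integrable_indicator_iff hS]
    exact integrableOn_const hSf
  refine (le_abs_self _).trans ?_
  rw [← Real.norm_eq_abs]
  refine norm_integral_le_of_norm_le hi2 (ae_of_all _ fun y => ?_)
  by_cases hy : y ∈ S
  · rw [indicator_of_mem hy, Real.norm_eq_abs, abs_mul]
    have := pot_le hS hSf zero_le_one h1 h2 y
    nlinarith [h1 y, abs_nonneg (f y), abs_nonneg (pot f y)]
  · rw [h2 y hy, indicator_of_notMem hy]; simp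

theorem zero_mem_perCand (Ω : Set E3) : (0:ℝ) ∈ perCand Ω := by
  refine ⟨fun _ => 0, contDiff_const, HasCompactSupport.zero, fun x => by simp, ?_⟩
  simp [divg]

theorem per_nonneg {Ω : Set E3} (h : HasFinPer Ω) : 0 ≤ per Ω :=
  le_csSup h (zero_mem_perCand Ω)

theorem per_le_of {Ω : Set E3} {m : ℝ} (h : ∀ a ∈ perCand Ω, a ≤ m) : per Ω ≤ m :=
  csSup_le ⟨0, zero_mem_perCand Ω⟩ h

theorem divg_eq_sum (φ : E3 → E3) (x : E3) :
    divg φ x = ∑ i, (fderiv ℝ φ x (EuclideanSpace.single i 1)) i := by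
  unfold divg
  rw [LinearMap.trace_eq_matrix_trace ℝ (EuclideanSpace.basisFun (Fin 3) ℝ).toBasis, Matrix.trace]
  simp [LinearMap.toMatrix_apply]

theorem divg_continuous {φ : E3 → E3} (h : ContDiff ℝ 1 φ) : Continuous (divg φ) := by
  have : divg φ = fun x => ∑ i, (fderiv ℝ φ x (EuclideanSpace.single i 1)) i := by
    ext x; exact divg_eq_sum φ x
  rw [this]
  have := h.continuous_fderiv one_ne_zero
  fun_prop

theorem divg_compact {φ : E3 → E3} (h : HasCompactSupport φ) : HasCompactSupport (divg φ) := by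
  have h1 := h.fderiv ℝ
  refine h1.mono ?_
  intro x hx hx2
  apply hx
  simp [divg, hx2]

theorem divg_integrable {φ : E3 → E3} (h : ContDiff ℝ 1 φ) (h' : HasCompactSupport φ) :
    Integrable (divg φ) :=
  (divg_continuous h).integrable_of_hasCompactSupport (divg_compact h')

theorem perCand_union_le {A B : Set E3} (hB : MeasurableSet B) (hd : Disjoint A B)
    (fA : HasFinPer A) (fB : HasFinPer B) : ∀ a ∈ perCand (A ∪ B), a ≤ per A + per B := by
  rintro a ⟨φ, h1, h2, h3, rfl⟩
  rw [setIntegral_union hd hB (divg_integrable h1 h2).integrableOn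
    (divg_integrable h1 h2).integrableOn]
  exact add_le_add (le_csSup fA ⟨φ, h1, h2, h3, rfl⟩) (le_csSup fB ⟨φ, h1, h2, h3, rfl⟩)

theorem finPer_empty : HasFinPer (∅ : Set E3) := by
  refine ⟨0, ?_⟩
  rintro a ⟨φ, h1, h2, h3, rfl⟩
  simp

theorem per_empty : per (∅ : Set E3) ≤ 0 := by
  apply per_le_of
  rintro a ⟨φ, h1, h2, h3, rfl⟩
  simp

/-- Rigid motions. -/
def sig (T : E3 ≃ₗᵢ[ℝ] E3) (a : E3) : E3 ≃ₜ E3 :=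
  T.toHomeomorph.trans (Homeomorph.addRight a)

theorem sig_apply (T : E3 ≃ₗᵢ[ℝ] E3) (a x : E3) : sig T a x = T x + a := rfl

theorem sig_symm_apply (T : E3 ≃ₗᵢ[ℝ] E3) (a x : E3) : (sig T a).symm x = T.symm (x + -a) := rfl

theorem sig_symm (T : E3 ≃ₗᵢ[ℝ] E3) (a : E3) :
    (sig T a).symm = sig T.symm (-(T.symm a)) := by
  ext1 x
  rw [sig_symm_apply, sig_apply, map_add, map_neg]

theorem sig_mp (T : E3 ≃ₗᵢ[ℝ] E3) (a : E3) : MeasurePreserving (sig T a) :=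
  (measurePreserving_add_right volume a).comp T.measurePreserving

theorem sig_emb (T : E3 ≃ₗᵢ[ℝ] E3) (a : E3) : MeasurableEmbedding (sig T a) :=
  (sig T a).measurableEmbedding

theorem perCand_sig_subset (T : E3 ≃ₗᵢ[ℝ] E3) (a : E3) (Ω : Set E3) :
    perCand (sig T a ⁻¹' Ω) ⊆ perCand Ω := by
  rintro _ ⟨φ, h1, h2, h3, rfl⟩
  refine ⟨fun y => T (φ ((sig T a).symm y)), ?_, ?_, ?_, ?_⟩
  · apply T.contDiff.comp
    apply h1.comp
    show ContDiff ℝ 1 (fun y => T.symm (y + -a))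
    exact T.symm.contDiff.comp (contDiff_id.add contDiff_const)
  · have := h2.comp_homeomorph (sig T a).symm
    exact this.comp_left (g := T) (map_zero T)
  · intro x
    rw [T.norm_map]
    exact h3 _
  · rw [← (sig_mp T a).setIntegral_preimage_emb (sig_emb T a)
      (divg fun y => T (φ ((sig T a).symm y))) Ω]
    congr 1
    ext x
    have hd : HasFDerivAt (fun y => T (φ ((sig T a).symm y)))
        ((T : E3 →L[ℝ] E3).comp ((fderiv ℝ φ x).comp (T.symm : E3 →L[ℝ] E3))) (sig T a x) := by
      have e1 : HasFDerivAt (fun y => (sig T a).symm y) (T.symm : E3 →L[ℝ] E3) (sig T a x) := by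
        show HasFDerivAt (fun y => T.symm (y + -a)) (T.symm : E3 →L[ℝ] E3) (sig T a x)
        have := ((T.symm : E3 →L[ℝ] E3).hasFDerivAt (x := sig T a x + -a)).comp (sig T a x)
          ((hasFDerivAt_id (𝕜 := ℝ) (sig T a x)).add_const (-a))
        rw [ContinuousLinearMap.comp_id] at this
        exact this
      have e2 : HasFDerivAt φ (fderiv ℝ φ x) ((sig T a).symm (sig T a x)) := by
        rw [Homeomorph.symm_apply_apply]
        exact (h1.differentiable one_ne_zero x).hasFDerivAt
      exact ((T : E3 →L[ℝ] E3).hasFDerivAt).comp (sig T a x) (e2.comp (sig T a x) e1)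
    unfold divg
    rw [hd.fderiv]
    have := LinearMap.trace_conj' (fderiv ℝ φ x : E3 →ₗ[ℝ] E3) T.toLinearEquiv
    rw [← this]
    congr 1

theorem perCand_sig (T : E3 ≃ₗᵢ[ℝ] E3) (a : E3) (Ω : Set E3) :
    perCand (sig T a ⁻¹' Ω) = perCand Ω := by
  apply Subset.antisymm (perCand_sig_subset T a Ω)
  have := perCand_sig_subset T.symm (-(T.symm a)) (sig T a ⁻¹' Ω)
  rw [← sig_symm, ← preimage_comp] at this
  simpa using this

theorem per_sig (T : E3 ≃ₗᵢ[ℝ] E3) (a : E3) (Ω : Set E3) : per (sig T a ⁻¹' Ω) = per Ω := by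
  unfold per; rw [perCand_sig]

theorem finPer_sig (T : E3 ≃ₗᵢ[ℝ] E3) (a : E3) (Ω : Set E3) :
    HasFinPer (sig T a ⁻¹' Ω) ↔ HasFinPer Ω := by
  unfold HasFinPer; rw [perCand_sig]

theorem vol_sig (T : E3 ≃ₗᵢ[ℝ] E3) (a : E3) (Ω : Set E3) : vol (sig T a ⁻¹' Ω) = vol Ω := by
  unfold vol
  rw [(sig_mp T a).measure_preimage_emb (sig_emb T a)]

theorem BB_sig (T : E3 ≃ₗᵢ[ℝ] E3) (a : E3) (f g : E3 → ℝ) :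
    BB (fun x => f (sig T a x)) (fun x => g (sig T a x)) = BB f g := by
  unfold BB
  rw [← (sig_mp T a).integral_comp (sig_emb T a) (fun x => ∫ y, f x * g y / ‖x - y‖)]
  congr 1
  ext x
  rw [← (sig_mp T a).integral_comp (sig_emb T a) (fun y => f (sig T a x) * g y / ‖sig T a x - y‖)]
  congr 1
  ext y
  have : ‖sig T a x - sig T a y‖ = ‖x - y‖ := by
    rw [sig_apply, sig_apply, add_sub_add_right_eq_sub, ← map_sub, T.norm_map]
  rw [this]

theorem chg_sig (T : E3 ≃ₗᵢ[ℝ] E3) (a : E3) (ρ : ℝ) (A B : Set E3) :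
    chg ρ (sig T a ⁻¹' A) (sig T a ⁻¹' B) = fun x => chg ρ A B (sig T a x) := by
  ext x
  rfl

theorem nice_sig (T : E3 ≃ₗᵢ[ℝ] E3) (a : E3) {f : E3 → ℝ} (hf : Nice f) :
    Nice (fun x => f (sig T a x)) := by
  obtain ⟨mf, M, hM, h1, h2⟩ := hf
  refine ⟨mf.comp (sig T a).continuous.measurable, M + ‖a‖, by positivity, fun x => ?_,
    fun x hx => ?_⟩
  · linarith [h1 (sig T a x), norm_nonneg a]
  · apply h2
    rw [sig_apply]
    have := norm_sub_le (T x + a) a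
    rw [add_sub_cancel_right, T.norm_map] at this
    linarith

/-- Boundary regularity: the `h`-neighbourhood of the frontier has volume at most `m h`. -/
def Reg (A : Set E3) (m h0 : ℝ) : Prop :=
  0 ≤ m ∧ ∀ h : ℝ, 0 < h → h ≤ h0 → volume (thickening h (frontier A)) ≤ ENNReal.ofReal (m * h)

theorem Reg.combine {A B D : Set E3} {m m' h0 : ℝ} (hA : Reg A m h0) (hB : Reg B m' h0)
    (h : frontier D ⊆ frontier A ∪ frontier B) : Reg D (m + m') h0 := by
  refine ⟨add_nonneg hA.1 hB.1, fun t ht ht0 => ?_⟩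
  calc volume (thickening t (frontier D)) ≤ volume (thickening t (frontier A ∪ frontier B)) :=
        measure_mono (thickening_subset_of_subset t h)
    _ ≤ _ := by
        rw [thickening_union]
        refine (measure_union_le _ _).trans ?_
        rw [add_mul, ENNReal.ofReal_add (mul_nonneg hA.1 ht.le) (mul_nonneg hB.1 ht.le)]
        exact add_le_add (hA.2 t ht ht0) (hB.2 t ht ht0)

theorem frontier_inter_subset' (A B : Set E3) : frontier (A ∩ B) ⊆ frontier A ∪ frontier B :=
  (frontier_inter_subset A B).trans
    (union_subset_union inter_subset_left inter_subset_right)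

theorem frontier_union_subset' (A B : Set E3) : frontier (A ∪ B) ⊆ frontier A ∪ frontier B :=
  (frontier_union_subset A B).trans
    (union_subset_union inter_subset_left inter_subset_right)

theorem Reg.inter {A B : Set E3} {m m' h0 : ℝ} (hA : Reg A m h0) (hB : Reg B m' h0) :
    Reg (A ∩ B) (m + m') h0 := hA.combine hB (frontier_inter_subset' A B)

theorem Reg.union {A B : Set E3} {m m' h0 : ℝ} (hA : Reg A m h0) (hB : Reg B m' h0) :
    Reg (A ∪ B) (m + m') h0 := hA.combine hB (frontier_union_subset' A B)

theorem Reg.compl {A : Set E3} {m h0 : ℝ} (hA : Reg A m h0) : Reg Aᶜ m h0 := by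
  unfold Reg; rw [frontier_compl]; exact hA

theorem Reg.diff {A B : Set E3} {m m' h0 : ℝ} (hA : Reg A m h0) (hB : Reg B m' h0) :
    Reg (A \ B) (m + m') h0 := by
  rw [Set.sdiff_eq]; exact hA.inter hB.compl

theorem reg_empty (h0 : ℝ) : Reg ∅ 0 h0 := ⟨le_rfl, fun h _ _ => by simp⟩

theorem Reg.mono {A : Set E3} {m m' h0 h1 : ℝ} (hA : Reg A m h0) (hm : m ≤ m') (hh : h1 ≤ h0) :
    Reg A m' h1 := by
  refine ⟨hA.1.trans hm, fun h h2 h3 => (hA.2 h h2 (h3.trans hh)).trans ?_⟩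
  exact ENNReal.ofReal_le_ofReal (by gcongr)

theorem Reg.frontier_null {A : Set E3} {m h0 : ℝ} (hA : Reg A m h0) (h0p : 0 < h0) :
    volume (frontier A) = 0 := by
  have h1 : Tendsto (fun h : ℝ => ENNReal.ofReal (m * h)) (𝓝[>] 0) (𝓝 0) := by
    have : Tendsto (fun h : ℝ => m * h) (𝓝[>] 0) (𝓝 (m * 0)) :=
      ((continuous_const_mul m).tendsto 0).mono_left nhdsWithin_le_nhds
    rw [mul_zero] at this
    have := ENNReal.tendsto_ofReal this
    simpa using this
  apply le_antisymm _ (zero_le)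
  refine ge_of_tendsto h1 ?_
  filter_upwards [Ioc_mem_nhdsGT h0p] with h hh
  exact (measure_mono (self_subset_thickening hh.1 _)).trans (hA.2 h hh.1 hh.2)

/-- A ball meeting both a set and its complement meets the frontier. -/
theorem exists_frontier_segment {A : Set E3} {x y : E3} (hx : x ∈ A) (hy : y ∉ A) :
    ∃ z ∈ frontier A, z ∈ segment ℝ x y := by
  have hc : IsPreconnected (segment ℝ x y) := (convex_segment x y).isPreconnected
  by_contra hcon
  push Not at hcon
  have key : ∀ z ∈ segment ℝ x y, z ∈ interior A ∨ z ∈ interior Aᶜ := by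
    intro z hz
    by_cases h1 : z ∈ interior A
    · exact Or.inl h1
    · right
      rw [interior_compl]
      intro hcl
      exact hcon z ⟨hcl, h1⟩ hz
  have hx' : x ∈ interior A := (key x (left_mem_segment ℝ x y)).resolve_right
    fun h => interior_subset h hx
  have hy' : y ∈ interior Aᶜ := (key y (right_mem_segment ℝ x y)).resolve_left
    fun h => hy (interior_subset h)
  obtain ⟨w, -, hw1, hw2⟩ := hc _ _ isOpen_interior isOpen_interior (fun z hz => key z hz)
    ⟨x, left_mem_segment ℝ x y, hx'⟩ ⟨y, right_mem_segment ℝ x y, hy'⟩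
  exact interior_subset hw2 (interior_subset hw1)

theorem dist_segment_le {x y z : E3} (hz : z ∈ segment ℝ x y) : dist x z ≤ dist x y := by
  have : segment ℝ x y ⊆ closedBall x (dist x y) :=
    (convex_closedBall x _).segment_subset (mem_closedBall_self dist_nonneg)
      (by rw [mem_closedBall, dist_comm])
  have := this hz
  rwa [mem_closedBall, dist_comm] at this

/-- The cutoff function. -/
def cutoff (A : Set E3) (h : ℝ) (x : E3) : ℝ := min 1 (infDist x Aᶜ / h)

theorem cutoff_lip (A : Set E3) {h : ℝ} (hh : 0 < h) :
    LipschitzWith (Real.toNNReal (1 / h)) (cutoff A h) := by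
  have h1 : LipschitzWith (Real.toNNReal (1/h)) (fun x => infDist x Aᶜ / h) := by
    apply LipschitzWith.of_dist_le_mul
    intro x y
    rw [Real.coe_toNNReal _ (by positivity), Real.dist_eq, ← sub_div, abs_div, abs_of_pos hh,
      div_eq_mul_one_div, mul_comm]
    have := (lipschitz_infDist_pt Aᶜ).dist_le_mul x y
    rw [Real.dist_eq] at this
    simp only [NNReal.coe_one, one_mul] at this
    gcongr
  exact h1.const_min 1

theorem cutoff_fderiv_le (A : Set E3) {h : ℝ} (hh : 0 < h) (x : E3) :
    ‖fderiv ℝ (cutoff A h) x‖ ≤ 1 / h := by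
  have := norm_fderiv_le_of_lipschitz ℝ (cutoff_lip A hh) (x₀ := x)
  rwa [Real.coe_toNNReal _ (by positivity)] at this

theorem cutoff_nonneg (A : Set E3) {h : ℝ} (hh : 0 < h) (x : E3) : 0 ≤ cutoff A h x :=
  le_min zero_le_one (div_nonneg infDist_nonneg hh.le)

theorem cutoff_fderiv_zero {A : Set E3} (hne : (Aᶜ).Nonempty) {h : ℝ} (hh : 0 < h) (x : E3)
    (hx : x ∉ thickening h (frontier A)) : fderiv ℝ (cutoff A h) x = 0 := by
  by_cases hxA : x ∈ A
  · have h1 : h ≤ infDist x Aᶜ := by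
      by_contra hlt
      push Not at hlt
      obtain ⟨y, hy, hd⟩ := (infDist_lt_iff hne).1 hlt
      obtain ⟨z, hz, hzs⟩ := exists_frontier_segment hxA hy
      exact hx (mem_thickening_iff.2 ⟨z, hz, (dist_segment_le hzs).trans_lt hd⟩)
    have hval : cutoff A h x = 1 := min_eq_left (by rwa [le_div_iff₀ hh, one_mul])
    have : IsLocalMax (cutoff A h) x := by
      refine Eventually.of_forall fun y => ?_
      rw [hval]; exact min_le_left _ _
    exact this.fderiv_eq_zero
  · have hval : cutoff A h x = 0 := by
      have : infDist x Aᶜ = 0 := infDist_zero_of_mem hxA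
      simp [cutoff, this]
    have : IsLocalMin (cutoff A h) x := by
      refine Eventually.of_forall fun y => ?_
      rw [hval]; exact cutoff_nonneg A hh y
    exact this.fderiv_eq_zero

theorem cutoff_ibp (A : Set E3) {h : ℝ} (hh : 0 < h) {φ : E3 → E3} (h1 : ContDiff ℝ 1 φ)
    (h2 : HasCompactSupport φ) :
    ∫ x, cutoff A h x * divg φ x = - ∫ x, fderiv ℝ (cutoff A h) x (φ x) := by
  have hl := cutoff_lip A hh
  set e : Fin 3 → E3 := fun i => EuclideanSpace.single i 1 with he
  have hcd : ∀ i : Fin 3, ContDiff ℝ 1 (fun x => φ x i) := fun i => by fun_prop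
  have hcs : ∀ i : Fin 3, HasCompactSupport (fun x => φ x i) := fun i =>
    h2.comp_left (g := fun v : E3 => v i) rfl
  have hcl : ∀ i : Fin 3, ∃ K, LipschitzWith K (fun x => φ x i) := fun i =>
    (hcd i).lipschitzWith_of_hasCompactSupport (hcs i) one_ne_zero
  have hi : ∀ i : Fin 3, ∫ x, lineDeriv ℝ (cutoff A h) x (e i) * φ x i =
      - ∫ x, cutoff A h x * (fderiv ℝ φ x (e i)) i := by
    intro i
    obtain ⟨K, hK⟩ := hcl i
    rw [LipschitzWith.integral_lineDeriv_mul_eq hl hK (hcs i) (e i), ← integral_neg]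
    congr 1
    ext x
    have hd : HasFDerivAt (fun x => φ x i)
        ((EuclideanSpace.proj i : E3 →L[ℝ] ℝ).comp (fderiv ℝ φ x)) x :=
      (EuclideanSpace.proj i : E3 →L[ℝ] ℝ).hasFDerivAt.comp x
        (h1.differentiable one_ne_zero x).hasFDerivAt
    have : lineDeriv ℝ (fun x => φ x i) x (-e i) = - (fderiv ℝ φ x (e i)) i := by
      rw [(hd.hasLineDerivAt _).lineDeriv]
      simp
    rw [this]; ring
  have hae := hl.ae_differentiableAt (μ := (volume : Measure E3))
  have hint1 : ∀ i : Fin 3, Integrable (fun x => lineDeriv ℝ (cutoff A h) x (e i) * φ x i) := by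
    intro i
    have hφi : Integrable (fun x => φ x i) :=
      (hcd i).continuous.integrable_of_hasCompactSupport (hcs i)
    refine hφi.bdd_mul (c := 1/h * ‖e i‖) ?_ ?_
    · exact (measurable_lineDeriv hl.continuous).aestronglyMeasurable
    · refine ae_of_all _ fun x => ?_
      have := norm_lineDeriv_le_of_lipschitz ℝ hl (x₀ := x) (v := e i)
      rwa [Real.coe_toNNReal _ (by positivity)] at this
  have hint2 : ∀ i : Fin 3, Integrable (fun x => cutoff A h x * (fderiv ℝ φ x (e i)) i) := by
    intro i
    have hc : Continuous (fun x => (fderiv ℝ φ x (e i)) i) := by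
      have := h1.continuous_fderiv one_ne_zero
      fun_prop
    have hs : HasCompactSupport (fun x => (fderiv ℝ φ x (e i)) i) :=
      (h2.fderiv ℝ).comp_left (g := fun L : E3 →L[ℝ] E3 => (L (e i)) i) rfl
    refine (hc.integrable_of_hasCompactSupport hs).bdd_mul (c := 1) ?_ ?_
    · exact hl.continuous.aestronglyMeasurable
    · refine ae_of_all _ fun x => ?_
      rw [Real.norm_eq_abs, abs_of_nonneg (cutoff_nonneg A hh x)]
      exact min_le_left _ _
  have e1 : ∫ x, fderiv ℝ (cutoff A h) x (φ x) =
      ∑ i, ∫ x, lineDeriv ℝ (cutoff A h) x (e i) * φ x i := by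
    rw [← integral_finsetSum _ fun i _ => hint1 i]
    refine integral_congr_ae ?_
    filter_upwards [hae] with x hx
    have hsum : φ x = ∑ i, φ x i • e i := by
      ext j
      simp [he, Pi.single_apply]
    conv_lhs => rw [hsum]
    rw [map_sum]
    congr 1
    ext i
    rw [map_smul, hx.lineDeriv_eq_fderiv, smul_eq_mul, mul_comm]
  have e2 : ∫ x, cutoff A h x * divg φ x = ∑ i, ∫ x, cutoff A h x * (fderiv ℝ φ x (e i)) i := by
    rw [← integral_finsetSum _ fun i _ => hint2 i]
    congr 1
    ext x
    rw [divg_eq_sum, Finset.mul_sum]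
  rw [e1, e2, ← Finset.sum_neg_distrib]
  congr 1
  ext i
  rw [hi i, neg_neg]

theorem Reg.perCand_le {A : Set E3} {m h0 : ℝ} (hA : Reg A m h0) (h0p : 0 < h0)
    (mA : MeasurableSet A) (hne : (Aᶜ).Nonempty) : ∀ a ∈ perCand A, a ≤ m := by
  rintro a ⟨φ, h1, h2, h3, rfl⟩
  set hk : ℕ → ℝ := fun k => h0 / (k + 1) with hhk
  have hkpos : ∀ k, 0 < hk k := fun k => by simp only [hhk]; positivity
  have hkle : ∀ k, hk k ≤ h0 := fun k => by
    simp only [hhk]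
    apply div_le_self h0p.le
    linarith [(Nat.cast_nonneg k : (0:ℝ) ≤ k)]
  have hklim : Tendsto hk atTop (𝓝 0) := by
    have := (tendsto_one_div_add_atTop_nhds_zero_nat (𝕜 := ℝ)).const_mul h0
    rw [mul_zero] at this
    refine this.congr fun k => ?_
    simp only [hhk]
    ring
  have hbound : ∀ k, ∫ x, cutoff A (hk k) x * divg φ x ≤ m := by
    intro k
    rw [cutoff_ibp A (hkpos k) h1 h2]
    refine (neg_le_abs _).trans ?_
    rw [← Real.norm_eq_abs]
    set S := thickening (hk k) (frontier A) with hS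
    have hSm : MeasurableSet S := isOpen_thickening.measurableSet
    have hSv := hA.2 (hk k) (hkpos k) (hkle k)
    have hSfin : volume S ≠ ⊤ := (hSv.trans_lt ENNReal.ofReal_lt_top).ne
    have hIntg : Integrable (S.indicator fun _ => 1 / hk k) := by
      rw [integrable_indicator_iff hSm]; exact integrableOn_const hSfin
    refine (norm_integral_le_of_norm_le hIntg (ae_of_all _ fun x => ?_)).trans ?_
    · by_cases hx : x ∈ S
      · rw [indicator_of_mem hx]
        refine (ContinuousLinearMap.le_opNorm _ _).trans ?_
        have := cutoff_fderiv_le A (hkpos k) x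
        nlinarith [h3 x, norm_nonneg (φ x), norm_nonneg (fderiv ℝ (cutoff A (hk k)) x)]
      · rw [indicator_of_notMem hx, cutoff_fderiv_zero hne (hkpos k) x hx]
        simp
    · rw [integral_indicator hSm]
      simp only [integral_const, smul_eq_mul, measureReal_restrict_apply_univ]
      have : volume.real S ≤ m * hk k :=
        ENNReal.toReal_le_of_le_ofReal (mul_nonneg hA.1 (hkpos k).le) hSv
      rw [mul_one_div, div_le_iff₀ (hkpos k)]
      exact this
  have hlim : Tendsto (fun k => ∫ x, cutoff A (hk k) x * divg φ x) atTop
      (𝓝 (∫ x, A.indicator (divg φ) x)) := by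
    refine tendsto_integral_of_dominated_convergence (fun x => ‖divg φ x‖) ?_ ?_ ?_ ?_
    · intro k
      exact ((cutoff_lip A (hkpos k)).continuous.mul (divg_continuous h1)).aestronglyMeasurable
    · exact (divg_integrable h1 h2).norm
    · intro k
      refine ae_of_all _ fun x => ?_
      rw [norm_mul, Real.norm_eq_abs, abs_of_nonneg (cutoff_nonneg A (hkpos k) x)]
      exact mul_le_of_le_one_left (norm_nonneg _) (min_le_left _ _)
    · have hnull : ∀ᵐ x : E3, x ∉ frontier A := by
        rw [ae_iff]; simpa using hA.frontier_null h0p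
      filter_upwards [hnull] with x hx
      by_cases hxA : x ∈ A
      · rw [indicator_of_mem hxA]
        have hpos : 0 < infDist x Aᶜ := by
          rw [← infDist_closure, ← (isClosed_closure).notMem_iff_infDist_pos hne.closure]
          intro hc
          exact hx ⟨subset_closure hxA, by
            rw [closure_compl] at hc; exact hc⟩
        refine tendsto_const_nhds.congr' ?_
        filter_upwards [hklim.eventually (gt_mem_nhds hpos)] with k hk'
        have : cutoff A (hk k) x = 1 :=
          min_eq_left (by rw [le_div_iff₀ (hkpos k), one_mul]; exact hk'.le)
        rw [this, one_mul]
      · rw [indicator_of_notMem hxA]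
        refine tendsto_const_nhds.congr fun k => ?_
        have : infDist x Aᶜ = 0 := infDist_zero_of_mem hxA
        simp [cutoff, this]
  rw [integral_indicator mA] at hlim
  exact le_of_tendsto hlim (Eventually.of_forall hbound)

/-- volume of the unit ball -/
def vb : ℝ := vol (ball (0:E3) 1)

theorem vb_pos : 0 < vb :=
  ENNReal.toReal_pos (measure_ball_pos volume _ one_pos).ne' measure_ball_lt_top.ne

theorem volume_ball_eq (z : E3) {R : ℝ} (hR : 0 ≤ R) :
    volume (ball z R) = ENNReal.ofReal (vb * R ^ 3) := by
  rw [Measure.addHaar_ball _ _ hR, mul_comm, ENNReal.ofReal_mul vb_pos.le]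
  congr 1
  · exact (ENNReal.ofReal_toReal measure_ball_lt_top.ne).symm
  · simp

theorem volume_pi_E3 (S : Fin 3 → Set ℝ) :
    volume {x : E3 | ∀ i, x i ∈ S i} = ∏ i, volume (S i) := by
  have h := EuclideanSpace.volume_preserving_symm_measurableEquiv_toLp (Fin 3)
  have h2 := h.measure_preimage_equiv (univ.pi S)
  rw [volume_pi_pi] at h2
  rw [← h2]
  congr 1
  ext x
  simp

/-- Half-open cube. -/
def cube (a : E3) (s : ℝ) : Set E3 := {x | ∀ i, x i ∈ Ico (a i) (a i + s)}

theorem volume_cube (a : E3) (s : ℝ) (hs : 0 ≤ s) : volume (cube a s) = ENNReal.ofReal (s ^ 3) := by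
  unfold cube
  rw [volume_pi_E3 fun i => Ico (a i) (a i + s)]
  simp [Real.volume_Ico, ENNReal.ofReal_pow hs]

theorem vol_cube (a : E3) (s : ℝ) (hs : 0 ≤ s) : vol (cube a s) = s ^ 3 := by
  unfold vol
  rw [volume_cube a s hs, ENNReal.toReal_ofReal (by positivity)]

theorem measurableSet_cube (a : E3) (s : ℝ) : MeasurableSet (cube a s) := by
  unfold cube
  simp only [ofPred_forall]
  refine MeasurableSet.iInter fun i => ?_
  exact measurableSet_Ico.preimage (by fun_prop)

theorem abs_coord_le (x : E3) (i : Fin 3) : |x i| ≤ ‖x‖ := by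
  have := EuclideanSpace.norm_eq x
  have h2 := PiLp.norm_apply_le x i
  simpa using h2

theorem norm_le_of_coord {x : E3} {t : ℝ} (ht : 0 ≤ t) (h : ∀ i, |x i| ≤ t) : ‖x‖ ≤ 2 * t := by
  rw [EuclideanSpace.norm_eq]
  apply Real.sqrt_le_iff.2
  refine ⟨by positivity, ?_⟩
  rw [Fin.sum_univ_three]
  have : ∀ i, ‖x i‖ ^ 2 ≤ t ^ 2 := fun i => by
    rw [Real.norm_eq_abs]; gcongr; exact h i
  nlinarith [this 0, this 1, this 2, sq_nonneg t]

theorem cube_dist {a : E3} {s : ℝ} {x y : E3} (hs : 0 < s) (hx : x ∈ cube a s)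
    (hy : y ∈ cube a s) : dist x y < 2 * s := by
  rw [dist_eq_norm, EuclideanSpace.norm_eq]
  apply (Real.sqrt_lt' (by positivity)).2
  rw [Fin.sum_univ_three]
  have : ∀ i, ‖(x - y) i‖ ^ 2 ≤ s ^ 2 := fun i => by
    rw [Real.norm_eq_abs]
    have h1 := hx i
    have h2 := hy i
    have : |(x - y) i| ≤ s := by
      simp only [PiLp.sub_apply]
      rw [abs_le]; constructor <;> linarith [h1.1, h1.2, h2.1, h2.2]
    gcongr
  nlinarith [this 0, this 1, this 2, sq_nonneg s]

theorem cube_bounded (a : E3) (s : ℝ) : IsBounded (cube a s) := by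
  rcases le_or_gt s 0 with hs | hs
  · have : cube a s = ∅ := by
      ext x
      simp only [cube, mem_ofPred_eq, mem_empty_iff_false, iff_false]
      intro h
      linarith [(h 0).1, (h 0).2]
    rw [this]; exact isBounded_empty
  · rw [Metric.isBounded_iff]
    exact ⟨2 * s, fun x hx y hy => (cube_dist hs hx hy).le⟩

/-- Frontier of sets sandwiched. -/
theorem reg_of_shell {A : Set E3} {m h0 : ℝ} (hm : 0 ≤ m)
    (h : ∀ h, 0 < h → h ≤ h0 → ∃ I O : Set E3, MeasurableSet I ∧ I ⊆ O ∧ 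
      thickening h (frontier A) ⊆ O \ I ∧ volume I ≠ ⊤ ∧
      volume O ≤ volume I + ENNReal.ofReal (m * h)) : Reg A m h0 := by
  refine ⟨hm, fun t ht ht0 => ?_⟩
  obtain ⟨I, O, h1, h2, h3, h4, h5⟩ := h t ht ht0
  refine (measure_mono h3).trans ?_
  rw [measure_sdiff h2 h1.nullMeasurableSet h4]
  rw [tsub_le_iff_left]; exact h5

theorem reg_ball (z : E3) {R h0 : ℝ} (hR : 0 ≤ R) :
    Reg (ball z R) (8 * vb * (R + h0) ^ 2) h0 := by
  have := vb_pos
  refine reg_of_shell (by positivity) fun h hh hh0 => ?_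
  refine ⟨ball z (max (R - h) 0), ball z (R + h), measurableSet_ball, ?_, ?_, ?_, ?_⟩
  · exact ball_subset_ball (max_le (by linarith) (by linarith))
  · intro x hx
    obtain ⟨y, hy, hxy⟩ := mem_thickening_iff.1 hx
    have hy' : dist y z = R := frontier_ball_subset_sphere hy
    refine ⟨?_, ?_⟩
    · rw [mem_ball]; linarith [dist_triangle x y z]
    · rw [mem_ball, lt_max_iff, not_or]
      constructor
      · linarith [dist_triangle y x z, dist_comm x y]
      · linarith [dist_nonneg (x := x) (y := z)]
  · exact measure_ball_lt_top.ne
  · rw [volume_ball_eq _ (by linarith), volume_ball_eq _ (le_max_right _ _),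
      ← ENNReal.ofReal_add (by positivity) (by positivity)]
    apply ENNReal.ofReal_le_ofReal
    rcases le_total h R with h1 | h1
    · rw [max_eq_left (by linarith)]
      have : (R + h) ^ 3 ≤ (R - h) ^ 3 + 8 * (R + h0) ^ 2 * h := by
        have : (R + h) ^ 2 ≤ (R + h0) ^ 2 := by gcongr
        nlinarith [mul_le_mul_of_nonneg_left this hh.le, mul_nonneg hR hh.le, sq_nonneg h, sq_nonneg R, mul_nonneg (mul_nonneg hR hh.le) hh.le, mul_nonneg (sq_nonneg R) hh.le,  mul_nonneg (sq_nonneg h) hh.le]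
      nlinarith
    · rw [max_eq_right (by linarith)]
      have : (R + h) ^ 3 ≤ 8 * (R + h0) ^ 2 * h := by
        have h3 : (R + h) ^ 2 ≤ (R + h0) ^ 2 := by gcongr
        have h4 : (R + h) ^ 2 * (R + h) ≤ (R + h0) ^ 2 * (2 * h) := by gcongr; linarith
        nlinarith [mul_nonneg (sq_nonneg (R + h0)) hh.le]
      nlinarith

theorem cube_frontier (a : E3) (s : ℝ) {y : E3} (hy : y ∈ frontier (cube a s)) :
    (∀ i, y i ∈ Icc (a i) (a i + s)) ∧ ∃ i, y i ∉ Ioo (a i) (a i + s) := by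
  have hc : IsClosed {x : E3 | ∀ i, x i ∈ Icc (a i) (a i + s)} := by
    simp only [ofPred_forall]
    exact isClosed_iInter fun i => isClosed_Icc.preimage (by fun_prop)
  have ho : IsOpen {x : E3 | ∀ i, x i ∈ Ioo (a i) (a i + s)} := by
    simp only [ofPred_forall]
    exact isOpen_iInter_of_finite fun i => isOpen_Ioo.preimage (by fun_prop)
  refine ⟨?_, ?_⟩
  · exact closure_minimal (s := cube a s) (t := {x : E3 | ∀ i, x i ∈ Icc (a i) (a i + s)})
      (fun x hx i => Ico_subset_Icc_self (hx i)) hc hy.1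
  · by_contra hcon
    push Not at hcon
    exact hy.2 (interior_maximal (s := cube a s) (t := {x : E3 | ∀ i, x i ∈ Ioo (a i) (a i + s)})
      (fun x hx i => Ioo_subset_Ico_self (hx i)) ho hcon)

theorem reg_cube (a : E3) {s h0 : ℝ} (hs : 0 ≤ s) :
    Reg (cube a s) (64 * (s + h0) ^ 2) h0 := by
  refine reg_of_shell (by positivity) fun h hh hh0 => ?_
  have hIm : MeasurableSet {x : E3 | ∀ i, x i ∈ Icc (a i + h) (a i + s - h)} := by
    simp only [ofPred_forall]
    refine MeasurableSet.iInter fun i => ?_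
    exact measurableSet_Icc.preimage (by fun_prop)
  refine ⟨{x : E3 | ∀ i, x i ∈ Icc (a i + h) (a i + s - h)},
    {x : E3 | ∀ i, x i ∈ Ioo (a i - h) (a i + s + h)}, hIm, ?_, ?_, ?_, ?_⟩
  · intro x hx i
    have := hx i
    exact ⟨by linarith [this.1], by linarith [this.2]⟩
  · intro x hx
    obtain ⟨y, hy, hxy⟩ := mem_thickening_iff.1 hx
    obtain ⟨h1, j, h2⟩ := cube_frontier a s hy
    have hc : ∀ i, |x i - y i| < h := fun i => by
      have := abs_coord_le (x - y) i
      rw [dist_eq_norm] at hxy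
      simp only [PiLp.sub_apply] at this
      linarith
    refine ⟨fun i => ?_, fun hI => h2 ?_⟩
    · have h3 := abs_lt.1 (hc i)
      have h4 := h1 i
      exact ⟨by linarith [h4.1, h4.2], by linarith [h4.1, h4.2]⟩
    · have h3 := abs_lt.1 (hc j)
      have h4 := hI j
      exact ⟨by linarith [h4.1, h4.2], by linarith [h4.1, h4.2]⟩
  · rw [volume_pi_E3 fun i => Icc (a i + h) (a i + s - h)]
    simp only [Real.volume_Icc]
    exact ENNReal.prod_ne_top fun i _ => ENNReal.ofReal_ne_top
  · rw [volume_pi_E3 fun i => Icc (a i + h) (a i + s - h),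
      volume_pi_E3 fun i => Ioo (a i - h) (a i + s + h)]
    simp only [Real.volume_Icc, Real.volume_Ioo]
    have e1 : ∀ i, a i + s + h - (a i - h) = s + 2 * h := fun i => by ring
    have e2 : ∀ i, a i + s - h - (a i + h) = s - 2 * h := fun i => by ring
    simp only [e1, e2, Finset.prod_const, Finset.card_univ, Fintype.card_fin]
    have hsq : (s + h) ^ 2 ≤ (s + h0) ^ 2 := by gcongr
    rcases le_total (2 * h) s with h1 | h1
    · rw [← ENNReal.ofReal_pow (by linarith), ← ENNReal.ofReal_pow (by linarith),
        ← ENNReal.ofReal_add (by have : 0 ≤ s - 2 * h := by linarith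
                                 positivity) (by positivity)]
      apply ENNReal.ofReal_le_ofReal
      nlinarith [mul_le_mul_of_nonneg_left hsq hh.le, mul_nonneg (mul_nonneg hs hh.le) hh.le, mul_nonneg (sq_nonneg s) hh.le,  mul_nonneg (sq_nonneg h) hh.le]
    · rw [← ENNReal.ofReal_pow (by linarith)]
      refine le_trans (ENNReal.ofReal_le_ofReal ?_) (le_add_left le_rfl)
      have h4 : (s + 2 * h) ^ 2 ≤ (2 * (s + h)) ^ 2 := by gcongr; linarith
      have h5 : (s + 2 * h) ^ 2 * (s + 2 * h) ≤ (4 * (s + h0) ^ 2) * (4 * h) := by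
        gcongr
        · nlinarith
        · linarith
      nlinarith [mul_nonneg (sq_nonneg (s + h0)) hh.le]

/-- The region `P` can be filled at cost `c` in any external field. -/
def Fill (ρ : ℝ) (P : Set E3) (c : ℝ) : Prop :=
  ∀ F : E3 → ℝ, Nice F → (∀ x ∈ P, F x = 0) → ∃ Ω, MeasurableSet Ω ∧ Ω ⊆ P ∧ HasFinPer Ω ∧
    vol Ω = ρ * vol P ∧
    per Ω + 1 / 2 * BB (chg ρ P Ω) (chg ρ P Ω) + BB F (chg ρ P Ω) ≤ c

/-- Variant of `Fill` for subsets of `U`, not accounting for the perimeter of `U`. -/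
def FillU (ρ : ℝ) (U P : Set E3) (h0 c : ℝ) : Prop :=
  ∀ F : E3 → ℝ, Nice F → (∀ x ∈ P, F x = 0) → ∃ V m, MeasurableSet V ∧ Reg V m h0 ∧ U ∩ V ⊆ P ∧
    vol (U ∩ V) = ρ * vol P ∧
    m + 1 / 2 * BB (chg ρ P (U ∩ V)) (chg ρ P (U ∩ V)) + BB F (chg ρ P (U ∩ V)) ≤ c

theorem chg_zero {ρ : ℝ} {P Ω : Set E3} (h : Ω ⊆ P) {x : E3} (hx : x ∉ P) : chg ρ P Ω x = 0 := by
  have : x ∉ Ω := fun h' => hx (h h')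
  simp [chg, hx, this]

theorem chg_abs_le {ρ : ℝ} (h0 : 0 ≤ ρ) (h1 : ρ ≤ 1) {P Ω : Set E3} (h : Ω ⊆ P) (x : E3) :
    |chg ρ P Ω x| ≤ 1 := by
  by_cases hx : x ∈ P
  · by_cases hx' : x ∈ Ω
    · simp only [chg, indicator_of_mem hx, indicator_of_mem hx']
      rw [abs_le]; constructor <;> linarith
    · simp only [chg, indicator_of_mem hx, indicator_of_notMem hx']
      rw [abs_le]; constructor <;> linarith
  · rw [chg_zero h hx]; simp

theorem chg_union {ρ : ℝ} {P P' Ω Ω' : Set E3} (hd : Disjoint P P') (h : Ω ⊆ P) (h' : Ω' ⊆ P') :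
    chg ρ (P ∪ P') (Ω ∪ Ω') = fun x => chg ρ P Ω x + chg ρ P' Ω' x := by
  ext x
  simp only [chg]
  rw [indicator_union_of_disjoint hd, indicator_union_of_disjoint (hd.mono h h')]
  ring

theorem vol_union {A B : Set E3} (hB : MeasurableSet B) (hd : Disjoint A B)
    (fA : IsBounded A) (fB : IsBounded B) : vol (A ∪ B) = vol A + vol B := by
  unfold vol
  rw [measure_union hd hB, ENNReal.toReal_add fA.measure_lt_top.ne fB.measure_lt_top.ne]

theorem energy_union {F f f' : E3 → ℝ} (hF : Nice F) (hf : Nice f) (hf' : Nice f') :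
    1 / 2 * BB (fun x => f x + f' x) (fun x => f x + f' x) + BB F (fun x => f x + f' x)
    = (1 / 2 * BB f f + BB F f) + (1 / 2 * BB f' f' + BB (fun x => F x + f x) f') := by
  rw [BB_add_add hf hf', BB_add_right hF hf hf', BB_add_left hF hf hf']
  ring

theorem Fill.mono {ρ : ℝ} {P : Set E3} {c c' : ℝ} (h : Fill ρ P c) (hc : c ≤ c') :
    Fill ρ P c' := fun F hF h0 => by
  obtain ⟨Ω, h1, h2, h3, h4, h5⟩ := h F hF h0
  exact ⟨Ω, h1, h2, h3, h4, h5.trans hc⟩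

theorem Fill.union {ρ : ℝ} {P P' : Set E3} {c c' : ℝ} (h : Fill ρ P c) (h' : Fill ρ P' c')
    (hd : Disjoint P P') (mP : MeasurableSet P) (mP' : MeasurableSet P') (bP : IsBounded P)
    (bP' : IsBounded P') : Fill ρ (P ∪ P') (c + c') := by
  intro F hF hF0
  obtain ⟨Ω, h1, h2, h3, h4, h5⟩ := h F hF fun x hx => hF0 x (Or.inl hx)
  have nf := nice_chg ρ mP h1 h2 bP
  obtain ⟨Ω', h1', h2', h3', h4', h5'⟩ := h' (fun x => F x + chg ρ P Ω x) (hF.add nf) fun x hx => by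
    rw [hF0 x (Or.inr hx), chg_zero h2 (fun hx' => hd.le_bot ⟨hx', hx⟩), add_zero]
  have nf' := nice_chg ρ mP' h1' h2' bP'
  have hdΩ : Disjoint Ω Ω' := hd.mono h2 h2'
  have hper := perCand_union_le h1' hdΩ h3 h3'
  refine ⟨Ω ∪ Ω', h1.union h1', union_subset_union h2 h2', ⟨_, hper⟩, ?_, ?_⟩
  · rw [vol_union h1' hdΩ (bP.subset h2) (bP'.subset h2'), vol_union mP' hd bP bP', h4, h4']; ring
  · rw [chg_union hd h2 h2', add_assoc, energy_union hF nf nf']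
    linarith [per_le_of hper]

theorem FillU.union {ρ : ℝ} {U P P' : Set E3} {h0 c c' : ℝ} (h : FillU ρ U P h0 c)
    (h' : FillU ρ U P' h0 c') (mU : MeasurableSet U)
    (hd : Disjoint P P') (mP : MeasurableSet P) (mP' : MeasurableSet P') (bP : IsBounded P)
    (bP' : IsBounded P') : FillU ρ U (P ∪ P') h0 (c + c') := by
  intro F hF hF0
  obtain ⟨V, m, h1, h2, h3, h4, h5⟩ := h F hF fun x hx => hF0 x (Or.inl hx)
  have nf := nice_chg ρ mP (mU.inter h1) h3 bP
  obtain ⟨V', m', h1', h2', h3', h4', h5'⟩ := h' (fun x => F x + chg ρ P (U ∩ V) x)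
      (hF.add nf) fun x hx => by
    rw [hF0 x (Or.inr hx), chg_zero h3 (fun hx' => hd.le_bot ⟨hx', hx⟩), add_zero]
  have nf' := nice_chg ρ mP' (mU.inter h1') h3' bP'
  have hdΩ : Disjoint (U ∩ V) (U ∩ V') := hd.mono h3 h3'
  refine ⟨V ∪ V', m + m', h1.union h1', h2.union h2', ?_, ?_, ?_⟩
  · rw [inter_union_distrib_left]; exact union_subset_union h3 h3'
  · rw [inter_union_distrib_left, vol_union (mU.inter h1') hdΩ (bP.subset h3) (bP'.subset h3'),
      vol_union mP' hd bP bP', h4, h4']; ring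
  · rw [inter_union_distrib_left, chg_union hd h3 h3', add_assoc, energy_union hF nf nf']
    linarith

theorem chg_empty (ρ : ℝ) : chg ρ ∅ ∅ = fun _ => 0 := by ext x; simp [chg]

theorem BB_zero_right (f : E3 → ℝ) : BB f (fun _ => 0) = 0 := by simp [BB]

theorem fill_empty (ρ : ℝ) : Fill ρ ∅ 0 := fun F _ _ => by
  refine ⟨∅, MeasurableSet.empty, le_rfl, finPer_empty, by simp [vol], ?_⟩
  rw [chg_empty, BB_zero_right, BB_zero_right]
  linarith [per_empty]

theorem fillU_empty (ρ : ℝ) (U : Set E3) (h0 : ℝ) : FillU ρ U ∅ h0 0 := fun F _ _ => by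
  refine ⟨∅, 0, MeasurableSet.empty, reg_empty h0, by simp, by simp [vol], ?_⟩
  rw [inter_empty, chg_empty, BB_zero_right, BB_zero_right]
  simp

theorem FillU.fill {ρ : ℝ} {U P : Set E3} {h0 c m : ℝ} (h : FillU ρ U P h0 c)
    (hU : Reg U m h0) (h0p : 0 < h0) (mU : MeasurableSet U) (bP : IsBounded P) :
    Fill ρ P (m + c) := by
  intro F hF hF0
  obtain ⟨V, m', h1, h2, h3, h4, h5⟩ := h F hF hF0
  have hne : ((U ∩ V)ᶜ).Nonempty := by
    rw [nonempty_compl]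
    intro hu
    have : IsBounded (univ : Set E3) := hu ▸ bP.subset h3
    exact NormedSpace.unbounded_univ ℝ E3 this
  have hper := (hU.inter h2).perCand_le h0p (mU.inter h1) hne
  exact ⟨U ∩ V, mU.inter h1, h3, ⟨_, hper⟩, h4, by linarith [per_le_of hper]⟩

theorem Fill.biUnion {ι : Type*} {ρ : ℝ} (s : Finset ι) {P : ι → Set E3} {c : ι → ℝ}
    (h : ∀ i ∈ s, Fill ρ (P i) (c i)) (hd : Pairwise fun i j => Disjoint (P i) (P j))
    (mP : ∀ i, MeasurableSet (P i)) (bP : ∀ i, IsBounded (P i)) :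
    Fill ρ (⋃ i ∈ s, P i) (∑ i ∈ s, c i) := by
  classical
  induction s using Finset.induction_on with
  | empty => simpa using fill_empty ρ
  | insert a s ha ih =>
    rw [Finset.set_biUnion_insert, Finset.sum_insert ha]
    refine (h a (Finset.mem_insert_self a s)).union
      (ih fun i hi => h i (Finset.mem_insert_of_mem hi)) ?_ (mP a)
      (Finset.measurableSet_biUnion s fun i _ => mP i) (bP a)
      ((isBounded_biUnion_finset s).2 fun i _ => bP i)
    rw [disjoint_iUnion₂_right]
    intro i hi
    exact hd fun e => ha (e ▸ hi)

theorem FillU.biUnion {ι : Type*} {ρ : ℝ} {U : Set E3} {h0 : ℝ} (s : Finset ι)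
    {P : ι → Set E3} {c : ι → ℝ} (mU : MeasurableSet U)
    (h : ∀ i ∈ s, FillU ρ U (P i) h0 (c i)) (hd : Pairwise fun i j => Disjoint (P i) (P j))
    (mP : ∀ i, MeasurableSet (P i)) (bP : ∀ i, IsBounded (P i)) :
    FillU ρ U (⋃ i ∈ s, P i) h0 (∑ i ∈ s, c i) := by
  classical
  induction s using Finset.induction_on with
  | empty => simpa using fillU_empty ρ U h0
  | insert a s ha ih =>
    rw [Finset.set_biUnion_insert, Finset.sum_insert ha]
    refine (h a (Finset.mem_insert_self a s)).union
      (ih fun i hi => h i (Finset.mem_insert_of_mem hi)) mU ?_ (mP a)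
      (Finset.measurableSet_biUnion s fun i _ => mP i) (bP a)
      ((isBounded_biUnion_finset s).2 fun i _ => bP i)
    rw [disjoint_iUnion₂_right]
    intro i hi
    exact hd fun e => ha (e ▸ hi)

theorem Fill.sig {ρ : ℝ} {P : Set E3} {c : ℝ} (h : Fill ρ P c) (T : E3 ≃ₗᵢ[ℝ] E3) (a : E3) :
    Fill ρ (sig T a ⁻¹' P) c := by
  intro F hF hF0
  have key : ∀ x, (_root_.sig T a).symm x = _root_.sig T.symm (-(T.symm a)) x := fun x => by
    rw [sig_symm]
  obtain ⟨Ω, h1, h2, h3, h4, h5⟩ := h (fun x => F (_root_.sig T.symm (-(T.symm a)) x))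
    (nice_sig _ _ hF) fun x hx => hF0 _ (by
      rw [← key, mem_preimage, Homeomorph.apply_symm_apply]; exact hx)
  refine ⟨_root_.sig T a ⁻¹' Ω, (sig_mp T a).measurable h1, preimage_mono h2,
    (finPer_sig T a Ω).2 h3, by rw [vol_sig, vol_sig, h4], ?_⟩
  rw [chg_sig, per_sig, BB_sig]
  have : BB F (fun x => chg ρ P Ω (_root_.sig T a x)) =
      BB (fun x => F (_root_.sig T.symm (-(T.symm a)) x)) (chg ρ P Ω) := by
    rw [← BB_sig T a (fun x => F (_root_.sig T.symm (-(T.symm a)) x)) (chg ρ P Ω)]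
    congr 1
    ext x
    rw [← key, Homeomorph.symm_apply_apply]
  rw [this]
  exact h5

theorem continuous_ball_integral {g : E3 → ℝ} (hg : Integrable g) (a : E3) :
    Continuous fun t : ℝ => ∫ x in ball a t, g x := by
  simp only [← integral_indicator measurableSet_ball]
  rw [continuous_iff_continuousAt]
  intro t0
  refine continuousAt_of_dominated (bound := fun x => ‖g x‖) ?_ ?_ hg.norm ?_
  · exact Eventually.of_forall fun t => (hg.indicator measurableSet_ball).aestronglyMeasurable
  · refine Eventually.of_forall fun t => ae_of_all _ fun x => ?_
    exact norm_indicator_le_norm_self _ _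
  · have hnull : ∀ᵐ x : E3, x ∉ sphere a t0 := by
      exact measure_eq_zero_iff_ae_notMem.1 (Measure.addHaar_sphere volume a t0)
    filter_upwards [hnull] with x hx
    have hx' : dist x a ≠ t0 := hx
    rcases lt_or_gt_of_ne hx' with h | h
    · have : ∀ᶠ t in 𝓝 t0, g x = (ball a t).indicator g x := by
        filter_upwards [lt_mem_nhds h] with t ht
        rw [indicator_of_mem (by exact ht)]
      exact (tendsto_const_nhds.congr' this).trans (by rw [this.self_of_nhds])
    · have : ∀ᶠ t in 𝓝 t0, 0 = (ball a t).indicator g x := by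
        filter_upwards [gt_mem_nhds h] with t ht
        rw [indicator_of_notMem (by rw [mem_ball]; exact not_lt.2 ht.le)]
      exact (tendsto_const_nhds.congr' this).trans (by rw [this.self_of_nhds])

/-- Choice of a good shell in a potential. -/
theorem exists_shell {u h : E3 → ℝ} (hu : Integrable u) (hh : Integrable h) (a : E3) {d v ρ : ℝ}
    (hd : 0 ≤ d) (hv : 0 ≤ v) (h0 : 0 ≤ ρ) (h1 : ρ ≤ 1)
    (hu1 : ∫ x in ball a d, u x = v) (hu2 : ∫ x, u x = v)
    (hh1 : ∫ x in ball a d, h x = 0) (hh2 : ∫ x, h x = 0)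
    (hmono : ∀ t, 0 ≤ ∫ x in ball a t, u x) (hmono' : ∀ t, ∫ x in ball a t, u x ≤ v) :
    ∃ t t' : ℝ, 0 ≤ t ∧ t ≤ d ∧ 0 ≤ t' ∧ t' ≤ d ∧ ∃ A : Set E3,
      (A = ball a t' \ ball a t ∨ A = (ball a t' \ ball a t)ᶜ) ∧
      ∫ x in A, u x = ρ * v ∧ ∫ x in A, h x ≤ 0 := by
  have cu := continuous_ball_integral hu a
  have ch := continuous_ball_integral hh a
  obtain ⟨t, ht, hmax⟩ := isCompact_Icc.exists_isMaxOn (nonempty_Icc.2 hd) ch.continuousOn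
  have z1 : ∫ x in ball a 0, u x = 0 := by simp
  have sub : ∀ {s s' : ℝ}, s ≤ s' → ∀ {g : E3 → ℝ}, Integrable g →
      ∫ x in ball a s' \ ball a s, g x = (∫ x in ball a s', g x) - ∫ x in ball a s, g x := by
    intro s s' hs g hg
    exact setIntegral_sdiff measurableSet_ball hg.integrableOn (ball_subset_ball hs)
  by_cases hc : (∫ x in ball a t, u x) + ρ * v ≤ v
  · have : (∫ x in ball a t, u x) + ρ * v ∈
        Icc (∫ x in ball a t, u x) (∫ x in ball a d, u x) :=
      ⟨by nlinarith, by rw [hu1]; exact hc⟩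
    obtain ⟨t', ht', e⟩ := intermediate_value_Icc ht.2 cu.continuousOn this
    have e' : ∫ x in ball a t', u x = (∫ x in ball a t, u x) + ρ * v := e
    refine ⟨t, t', ht.1, ht.2, ht.1.trans ht'.1, ht'.2, _, Or.inl rfl, ?_, ?_⟩
    · rw [sub ht'.1 hu, e']; ring
    · rw [sub ht'.1 hh]
      have := hmax ⟨ht.1.trans ht'.1, ht'.2⟩
      simp only [mem_ofPred_eq] at this
      linarith
  · push Not at hc
    have : (∫ x in ball a t, u x) + ρ * v - v ∈
        Icc (∫ x in ball a 0, u x) (∫ x in ball a t, u x) :=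
      ⟨by rw [z1]; linarith, by nlinarith⟩
    obtain ⟨t', ht', e⟩ := intermediate_value_Icc ht.1 cu.continuousOn this
    have e' : ∫ x in ball a t', u x = (∫ x in ball a t, u x) + ρ * v - v := e
    have cm : ∀ {g : E3 → ℝ}, Integrable g → ∫ x in (ball a t \ ball a t')ᶜ, g x =
        (∫ x, g x) - ∫ x in ball a t \ ball a t', g x := by
      intro g hg
      have := integral_add_compl (measurableSet_ball.diff measurableSet_ball :
        MeasurableSet (ball a t \ ball a t')) hg
      linarith
    refine ⟨t', t, ht'.1, ht'.2.trans ht.2, ht.1, ht.2, _, Or.inr rfl, ?_, ?_⟩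
    · rw [cm hu, sub ht'.2 hu, e', hu2]; ring
    · rw [cm hh, sub ht'.2 hh, hh2]
      have := hmax ⟨ht'.1, ht'.2.trans ht.2⟩
      simp only [mem_ofPred_eq] at this
      linarith

/-- The constant for a cell. -/
def cellC (s h0 : ℝ) : ℝ :=
  64 * (s + h0) ^ 2 + 16 * vb * (2 * s + h0) ^ 2 + 1 / 2 * (s ^ 3 * (potC + s ^ 3))

theorem cell_fill {ρ : ℝ} (h0 : 0 ≤ ρ) (h1 : ρ ≤ 1) {U : Set E3} (mU : MeasurableSet U)
    (a : E3) {s k : ℝ} (hs : 0 < s) (hk : 0 < k) :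
    FillU ρ U (U ∩ cube a s) k (cellC s k) := by
  intro F hF _
  set P := U ∩ cube a s with hP
  have mP : MeasurableSet P := mU.inter (measurableSet_cube a s)
  have bP : IsBounded P := (cube_bounded a s).subset inter_subset_right
  have ha : a ∈ cube a s := fun i => ⟨le_rfl, by linarith⟩
  have hPb : P ⊆ ball a (2 * s) := fun x hx => cube_dist hs hx.2 ha
  set u : E3 → ℝ := P.indicator fun _ => 1 with hu
  have nu : Nice u := nice_indicator mP bP
  have iu := nu.integrable
  have ip := integrable_mul_pot nu hF
  set v := vol P with hv
  have v0 : 0 ≤ v := ENNReal.toReal_nonneg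
  have intu : ∀ A : Set E3, MeasurableSet A → ∫ x in A, u x = vol (P ∩ A) := by
    intro A hA
    rw [hu, setIntegral_indicator mP, inter_comm]
    simp [vol, Measure.real]
  have intu' : ∫ x, u x = v := by
    have := intu univ MeasurableSet.univ
    simpa using this
  set c := (∫ x, u x * pot F x) / v with hc
  have hcv : c * v = ∫ x, u x * pot F x := by
    by_cases hv0 : v = 0
    · rw [hv0, mul_zero]
      have hnull : volume P = 0 := by
        rcases (ENNReal.toReal_eq_zero_iff _).1 hv0 with h | h
        · exact h
        · exact absurd h bP.measure_lt_top.ne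
      symm
      apply integral_eq_zero_of_ae
      filter_upwards [measure_eq_zero_iff_ae_notMem.1 hnull] with x hx
      simp [hu, hx]
    · rw [hc, div_mul_cancel₀ _ hv0]
  set h : E3 → ℝ := fun x => u x * pot F x - c * u x with hh
  have ih : Integrable h := ip.sub (iu.const_mul c)
  have inth : ∫ x, h x = 0 := by
    rw [hh, integral_sub ip (iu.const_mul c), integral_const_mul, intu', hcv, sub_self]
  have hout : ∀ g : E3 → ℝ, (∀ x, x ∉ P → g x = 0) →
      ∫ x in ball a (2 * s), g x = ∫ x, g x := by
    intro g hg
    exact setIntegral_eq_integral_of_forall_compl_eq_zero fun x hx => hg x fun hx' => hx (hPb hx')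
  have u0 : ∀ x, x ∉ P → u x = 0 := fun x hx => by simp [hu, hx]
  have volm : ∀ A : Set E3, vol (P ∩ A) ≤ v := fun A =>
    ENNReal.toReal_mono bP.measure_lt_top.ne (measure_mono inter_subset_left)
  obtain ⟨t, t', ht0, htd, ht0', htd', A, hA, hA1, hA2⟩ := exists_shell iu ih a (d := 2 * s)
    (by positivity) v0 h0 h1 ((hout u u0).trans intu') intu'
    ((hout h fun x hx => by simp [hh, u0 x hx]).trans inth) inth
    (fun t => by rw [intu _ measurableSet_ball]; exact ENNReal.toReal_nonneg)
    (fun t => by rw [intu _ measurableSet_ball]; exact volm _)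
  have hvb := vb_pos
  have mA : MeasurableSet A := by
    rcases hA with rfl | rfl
    · exact measurableSet_ball.diff measurableSet_ball
    · exact (measurableSet_ball.diff measurableSet_ball).compl
  have rA : Reg A (16 * vb * (2 * s + k) ^ 2) k := by
    have r1 : Reg (ball a t' \ ball a t) (16 * vb * (2 * s + k) ^ 2) k := by
      refine ((reg_ball a (h0 := k) ht0').diff (reg_ball a ht0)).mono ?_ le_rfl
      have e1 : (t + k) ^ 2 ≤ (2 * s + k) ^ 2 := by gcongr
      have e2 : (t' + k) ^ 2 ≤ (2 * s + k) ^ 2 := by gcongr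
      nlinarith
    rcases hA with rfl | rfl
    · exact r1
    · exact r1.compl
  refine ⟨cube a s ∩ A, _, (measurableSet_cube a s).inter mA,
    (reg_cube a hs.le).inter rA, ?_, ?_, ?_⟩
  · rw [← inter_assoc]; exact inter_subset_left
  · rw [← inter_assoc, ← hP, ← intu A mA, hA1]
  · rw [← inter_assoc, ← hP]
    have nf : Nice (chg ρ P (P ∩ A)) := nice_chg ρ mP (mP.inter mA) inter_subset_left bP
    have hself : BB (chg ρ P (P ∩ A)) (chg ρ P (P ∩ A)) ≤ s ^ 3 * (potC + s ^ 3) := by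
      refine (BB_self_le mP bP.measure_lt_top.ne (chg_abs_le h0 h1 inter_subset_left)
        fun x hx => chg_zero inter_subset_left hx).trans ?_
      have : vol P ≤ s ^ 3 := by
        rw [← vol_cube a s hs.le]
        exact ENNReal.toReal_mono (cube_bounded a s).measure_lt_top.ne
          (measure_mono inter_subset_right)
      have := potC_nonneg
      gcongr
    have hBF : BB F (chg ρ P (P ∩ A)) ≤ 0 := by
      rw [BB_symm hF nf, BB_eq_pot]
      have e : (fun x => chg ρ P (P ∩ A) x * pot F x) = fun x =>
          A.indicator h x + (c * A.indicator u x - ρ * (u x * pot F x)) := by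
        ext x
        simp only [chg, hh, hu]
        by_cases hx : x ∈ P <;> by_cases hx' : x ∈ A <;> simp [hx, hx'] <;> ring
      have i2 : Integrable fun x => c * A.indicator u x - ρ * (u x * pot F x) :=
        ((iu.indicator mA).const_mul c).sub (ip.const_mul ρ)
      rw [e, integral_add (ih.indicator mA) i2,
        integral_sub ((iu.indicator mA).const_mul c) (ip.const_mul ρ), integral_const_mul,
        integral_const_mul, integral_indicator mA, integral_indicator mA, hA1, ← hcv]
      nlinarith
    unfold cellC
    linarith

abbrev E2 : Type := EuclideanSpace ℝ (Fin 2)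

theorem newton_inner1 {b q : ℝ} (hb : 0 < b) (hq : 0 ≤ q) :
    ∫ u in Ioi (0:ℝ), u * (if u ^ 2 < q then 1 / √(b ^ 2 + u ^ 2) else 0) = √(b ^ 2 + q) - b := by
  have e1 : ∫ u in Ioi (0:ℝ), u * (if u ^ 2 < q then 1 / √(b ^ 2 + u ^ 2) else 0) =
      ∫ u in Ioo 0 (√q), u / √(b ^ 2 + u ^ 2) := by
    rw [← integral_indicator measurableSet_Ioi, ← integral_indicator measurableSet_Ioo]
    congr 1
    ext u
    by_cases hu : 0 < u
    · have : u ^ 2 < q ↔ u < √q := (Real.lt_sqrt hu.le).symm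
      by_cases h2 : u < √q
      · rw [indicator_of_mem (by exact hu), indicator_of_mem (by exact ⟨hu, h2⟩),
          if_pos (this.2 h2)]
        ring
      · rw [indicator_of_mem (by exact hu), indicator_of_notMem (fun h => h2 h.2),
          if_neg (fun h => h2 (this.1 h))]
        ring
    · rw [indicator_of_notMem (by exact hu), indicator_of_notMem (fun h => hu h.1)]
  rw [e1, ← integral_Ioc_eq_integral_Ioo, ← intervalIntegral.integral_of_le (Real.sqrt_nonneg q)]
  have hpos : ∀ u : ℝ, 0 < b ^ 2 + u ^ 2 := fun u => by positivity
  have hd : ∀ u ∈ uIcc 0 (√q), HasDerivAt (fun u => √(b ^ 2 + u ^ 2)) (u / √(b ^ 2 + u ^ 2)) u := by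
    intro u _
    have h1 : HasDerivAt (fun u : ℝ => b ^ 2 + u ^ 2) (2 * u) u := by
      simpa using (hasDerivAt_pow 2 u).const_add (b ^ 2)
    have := h1.sqrt (hpos u).ne'
    convert this using 1
    field_simp
  rw [intervalIntegral.integral_eq_sub_of_hasDerivAt hd]
  · rw [Real.sq_sqrt hq]
    simp [Real.sqrt_sq hb.le]
  · apply Continuous.intervalIntegrable
    exact continuous_id.div (by fun_prop) fun u => (Real.sqrt_pos.2 (hpos u)).ne'

theorem newton_inner2 {b q : ℝ} (hb : 0 < b) (hq : 0 ≤ q) :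
    ∫ w : E2, (if ‖w‖ ^ 2 < q then 1 / √(b ^ 2 + ‖w‖ ^ 2) else 0) =
      2 * Real.pi * (√(b ^ 2 + q) - b) := by
  rw [integral_fun_norm_addHaar (volume : Measure E2)
    (fun u => if u ^ 2 < q then 1 / √(b ^ 2 + u ^ 2) else 0)]
  have hv : (volume : Measure E2).real (ball 0 1) = Real.pi := by
    simp [Measure.real, EuclideanSpace.volume_ball_fin_two, Real.pi_pos.le]
  rw [hv]
  simp only [finrank_euclideanSpace, Fintype.card_fin, nsmul_eq_mul, smul_eq_mul]
  have := newton_inner1 hb hq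
  norm_num
  norm_num at this
  rw [this]
  ring

theorem newton_outer {a r : ℝ} (hr : 0 < r) (hra : r < a) :
    ∫ t in (-r)..r, 2 * Real.pi * (√((a - t) ^ 2 + (r ^ 2 - t ^ 2)) - (a - t)) =
      4 * Real.pi * r ^ 3 / (3 * a) := by
  have ha : 0 < a := hr.trans hra
  have hpos : ∀ t ∈ uIcc (-r) r, 0 < (a - t) ^ 2 + (r ^ 2 - t ^ 2) := by
    intro t ht
    rw [uIcc_of_le (by linarith)] at ht
    have : 0 < a - t := by linarith [ht.2]
    have h2 : t ^ 2 ≤ r ^ 2 := by nlinarith [ht.1, ht.2]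
    nlinarith
  have hd : ∀ t ∈ uIcc (-r) r, HasDerivAt
      (fun t => 2 * Real.pi * (-(√((a - t) ^ 2 + (r ^ 2 - t ^ 2))) ^ 3 / (3 * a) - a * t + t ^ 2 / 2))
      (2 * Real.pi * (√((a - t) ^ 2 + (r ^ 2 - t ^ 2)) - (a - t))) t := by
    intro t ht
    have hp := hpos t ht
    have hs := Real.sqrt_pos.2 hp
    have h1 : HasDerivAt (fun t : ℝ => (a - t) ^ 2 + (r ^ 2 - t ^ 2)) (-2 * a) t := by
      have h2 : HasDerivAt (fun t : ℝ => (a - t)) (-1) t := by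
        simpa using (hasDerivAt_id t).const_sub a
      have := (h2.pow 2).add ((hasDerivAt_pow 2 t).const_sub (r ^ 2))
      refine HasDerivAt.congr_deriv this ?_
      push_cast
      ring
    have h3 := (h1.sqrt hp.ne').pow 3
    have h4 := ((((h3.neg.div_const (3 * a)).sub ((hasDerivAt_id t).const_mul a)).add
      ((hasDerivAt_pow 2 t).div_const 2))).const_mul (2 * Real.pi)
    refine HasDerivAt.congr_deriv h4 ?_
    push_cast
    field_simp
    ring
  rw [intervalIntegral.integral_eq_sub_of_hasDerivAt hd]
  · have s1 : √((a - r) ^ 2 + (r ^ 2 - r ^ 2)) = a - r := by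
      rw [sub_self, add_zero, Real.sqrt_sq (by linarith)]
    have s2 : √((a - -r) ^ 2 + (r ^ 2 - (-r) ^ 2)) = a + r := by
      rw [neg_sq, sub_self, add_zero, sub_neg_eq_add, Real.sqrt_sq (by linarith)]
    rw [s1, s2]
    field_simp
    ring
  · apply Continuous.intervalIntegrable
    fun_prop

/-- Splitting off the first coordinate. -/
def split : E3 ≃ᵐ ℝ × E2 :=
  ((MeasurableEquiv.toLp 2 (Fin 3 → ℝ)).symm.trans
    (MeasurableEquiv.piFinSuccAbove (fun _ => ℝ) 0)).trans
    (MeasurableEquiv.prodCongr (MeasurableEquiv.refl ℝ) (MeasurableEquiv.toLp 2 (Fin 2 → ℝ)))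

theorem split_mp : MeasurePreserving split := by
  refine MeasurePreserving.trans (MeasurePreserving.trans
    (EuclideanSpace.volume_preserving_symm_measurableEquiv_toLp (Fin 3))
    (volume_preserving_piFinSuccAbove (fun _ => ℝ) 0)) ?_
  exact (MeasurePreserving.id volume).prod
    (EuclideanSpace.volume_preserving_symm_measurableEquiv_toLp (Fin 2)).symm

theorem split_fst (x : E3) : (split x).1 = x 0 := rfl
theorem split_snd (x : E3) (i : Fin 2) : (split x).2 i = x i.succ := rfl

theorem split_norm (x : E3) : ‖x‖ ^ 2 = (split x).1 ^ 2 + ‖(split x).2‖ ^ 2 := by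
  rw [EuclideanSpace.norm_sq_eq, EuclideanSpace.norm_sq_eq, Fin.sum_univ_succ]
  simp [split_fst, split_snd]

theorem newton_axis {a r : ℝ} (hr : 0 < r) (hra : r < a) :
    ∫ y in ball (0:E3) r, 1 / ‖EuclideanSpace.single 0 a - y‖ =
      4 * Real.pi * r ^ 3 / (3 * a) := by
  set G : ℝ × E2 → ℝ := fun p =>
    if ‖p.2‖ ^ 2 < r ^ 2 - p.1 ^ 2 then 1 / √((a - p.1) ^ 2 + ‖p.2‖ ^ 2) else 0 with hG
  have e1 : ∀ y : E3, (ball (0:E3) r).indicator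
      (fun y => 1 / ‖(EuclideanSpace.single 0 a : E3) - y‖) y = G (split y) := by
    intro y
    have h1 : ‖(EuclideanSpace.single 0 a : E3) - y‖ =
        √((a - (split y).1) ^ 2 + ‖(split y).2‖ ^ 2) := by
      rw [← Real.sqrt_sq (norm_nonneg _), split_norm]
      congr 2
      rw [EuclideanSpace.norm_sq_eq, EuclideanSpace.norm_sq_eq]
      simp [split_snd]
    have h2 : y ∈ ball (0:E3) r ↔ ‖(split y).2‖ ^ 2 < r ^ 2 - (split y).1 ^ 2 := by
      rw [mem_ball_zero_iff, ← sq_lt_sq₀ (norm_nonneg _) hr.le, split_norm]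
      constructor <;> intro h <;> linarith
    by_cases hy : y ∈ ball (0:E3) r
    · rw [indicator_of_mem hy, hG]
      simp only
      rw [if_pos (h2.1 hy), h1]
    · rw [indicator_of_notMem hy, hG]
      simp only
      rw [if_neg (fun h => hy (h2.2 h))]
  have hI : Integrable ((ball (0:E3) r).indicator
      (fun y => 1 / ‖(EuclideanSpace.single 0 a : E3) - y‖)) := by
    rw [integrable_indicator_iff measurableSet_ball]
    refine Measure.integrableOn_of_bounded (M := 1 / (a - r)) measure_ball_lt_top.ne ?_ ?_
    · exact (by fun_prop : Measurable _).aestronglyMeasurable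
    · refine (ae_restrict_iff' measurableSet_ball).2 (ae_of_all _ fun y hy => ?_)
      rw [mem_ball_zero_iff] at hy
      have h3 := norm_sub_norm_le (EuclideanSpace.single 0 a : E3) y
      have h4 : ‖(EuclideanSpace.single 0 a : E3)‖ = a := by
        simp [abs_of_pos (hr.trans hra)]
      rw [Real.norm_eq_abs, abs_of_nonneg (by positivity)]
      apply one_div_le_one_div_of_le <;> linarith
  have hIG : Integrable G := by
    rw [← split_mp.integrable_comp_emb split.measurableEmbedding]
    exact hI.congr (ae_of_all _ e1)
  rw [← integral_indicator measurableSet_ball]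
  rw [integral_congr_ae (ae_of_all _ e1), split_mp.integral_comp split.measurableEmbedding G]
  rw [Measure.volume_eq_prod, integral_prod G hIG]
  have e2 : ∀ t : ℝ, ∫ w : E2, G (t, w) = (Ioo (-r) r).indicator
      (fun t => 2 * Real.pi * (√((a - t) ^ 2 + (r ^ 2 - t ^ 2)) - (a - t))) t := by
    intro t
    by_cases ht : t ∈ Ioo (-r) r
    · rw [indicator_of_mem ht]
      exact newton_inner2 (b := a - t) (q := r ^ 2 - t ^ 2) (by linarith [ht.2]) (by nlinarith [ht.1, ht.2])
    · rw [indicator_of_notMem ht]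
      have : r ^ 2 ≤ t ^ 2 := by
        by_contra h
        push Not at h
        exact ht (abs_lt.1 (by rw [← abs_of_pos hr]; exact sq_lt_sq.1 h))
      have : ∀ w : E2, G (t, w) = 0 := fun w => if_neg (by
        have := sq_nonneg ‖w‖
        simp only; linarith)
      simp [this]
  simp only [e2]
  rw [integral_indicator measurableSet_Ioo, ← integral_Ioc_eq_integral_Ioo,
    ← intervalIntegral.integral_of_le (by linarith), newton_outer hr hra]

theorem exists_isom {x y : E3} (h : ‖x‖ = ‖y‖) : ∃ T : E3 ≃ₗᵢ[ℝ] E3, T x = y :=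
  ⟨_, Submodule.reflection_sub h⟩

theorem newton_ball {x : E3} {r : ℝ} (hr : 0 < r) (hx : r < ‖x‖) :
    ∫ y in ball (0:E3) r, 1 / ‖x - y‖ = vb * r ^ 3 / ‖x‖ := by
  have hv : vb = Real.pi * 4 / 3 := by
    unfold vb vol
    rw [EuclideanSpace.volume_ball_fin_three]
    simp
    have := Real.pi_pos
    positivity
  have hn : ‖x‖ = ‖(EuclideanSpace.single 0 ‖x‖ : E3)‖ := by simp
  obtain ⟨T, hT⟩ := exists_isom hn
  have := newton_axis hr hx
  rw [← hT, ← integral_indicator measurableSet_ball,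
    ← (sig_mp T 0).integral_comp (sig_emb T 0)] at this
  rw [← integral_indicator measurableSet_ball]
  have e : ∀ y, (ball (0:E3) r).indicator (fun y => 1 / ‖T x - y‖) (sig T 0 y) =
      (ball (0:E3) r).indicator (fun y => 1 / ‖x - y‖) y := by
    intro y
    rw [sig_apply, add_zero]
    by_cases hy : y ∈ ball (0:E3) r
    · have : T y ∈ ball (0:E3) r := by simpa using hy
      rw [indicator_of_mem hy, indicator_of_mem this, ← map_sub, T.norm_map]
    · have : T y ∉ ball (0:E3) r := by simpa using hy
      rw [indicator_of_notMem hy, indicator_of_notMem this]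
  simp only [e] at this
  rw [this, hv]
  ring

/-- The orthogonal group. -/
abbrev GG : Type := unitary (E3 →L[ℝ] E3)

/-- The isometry associated with a group element. -/
def gi (g : GG) : E3 ≃ₗᵢ[ℝ] E3 := Unitary.linearIsometryEquiv g

theorem gi_apply (g : GG) (x : E3) : gi g x = (g : E3 →L[ℝ] E3) x := rfl

theorem gi_mul (g h : GG) (x : E3) : gi (g * h) x = gi g (gi h x) := rfl

theorem gi_surj (T : E3 ≃ₗᵢ[ℝ] E3) : ∃ g : GG, gi g = T :=
  ⟨Unitary.linearIsometryEquiv.symm T, Unitary.linearIsometryEquiv.apply_symm_apply T⟩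

theorem gi_symm (g : GG) (x : E3) : (gi g).symm x = gi g⁻¹ x := by
  rw [LinearIsometryEquiv.symm_apply_eq, ← gi_mul, mul_inv_cancel]
  rfl

instance : ContinuousStar (E3 →L[ℝ] E3) :=
  ⟨(ContinuousLinearMap.adjoint (𝕜 := ℝ) (E := E3) (F := E3)).continuous⟩

instance : CompactSpace GG := by
  have : ProperSpace (E3 →L[ℝ] E3) := FiniteDimensional.proper ℝ _
  refine isCompact_iff_compactSpace.1 ?_
  refine Metric.isCompact_of_isClosed_isBounded isClosed_unitary ?_
  refine (isBounded_closedBall (x := (0 : E3 →L[ℝ] E3)) (r := 1)).subset fun u hu => ?_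
  rw [mem_closedBall_zero_iff]
  exact (CStarRing.norm_of_mem_unitary hu).le

instance : SecondCountableTopology GG := by
  have : ProperSpace (E3 →L[ℝ] E3) := FiniteDimensional.proper ℝ _
  infer_instance

instance : MeasurableSpace GG := borel GG
instance : BorelSpace GG := ⟨rfl⟩

/-- Normalized Haar measure. -/
def hm : Measure GG := Measure.haarMeasure ⊤

instance : IsProbabilityMeasure hm := ⟨by
  have := Measure.haarMeasure_self (G := GG) (K₀ := ⊤)
  simpa [hm] using this⟩

instance : Measure.IsMulLeftInvariant hm := by unfold hm; infer_instance

theorem continuous_gi : Continuous fun p : GG × E3 => (gi p.1).symm p.2 := by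
  simp only [gi_symm, gi_apply]
  have h1 : Continuous fun p : GG × E3 => ((p.1⁻¹ : GG) : E3 →L[ℝ] E3) :=
    continuous_subtype_val.comp (continuous_inv.comp continuous_fst)
  exact h1.clm_apply continuous_snd


theorem pot_measurable {F : E3 → ℝ} (hF : Nice F) : Measurable (pot F) := by
  have h : Measurable fun p : E3 × E3 => F p.2 / ‖p.1 - p.2‖ :=
    (hF.1.comp measurable_snd).div (by fun_prop)
  exact (h.stronglyMeasurable.integral_prod_right' (ν := volume)).measurable

theorem pot_bdd {F : E3 → ℝ} (hF : Nice F) : ∃ C, ∀ x, |pot F x| ≤ C := by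
  obtain ⟨h1, M, hM, h2, h3⟩ := hF
  refine ⟨_, pot_le (S := ball 0 M) measurableSet_ball measure_ball_lt_top.ne hM.le h2
    fun x hx => h3 x ?_⟩
  simpa using hx

theorem pot_cont {F : E3 → ℝ} (hF : Nice F) {R : ℝ} (h0 : ∀ x ∈ ball (0:E3) R, F x = 0) {y : E3}
    (hy : ‖y‖ < R) : ContinuousAt (pot F) y := by
  have hgap : 0 < (R - ‖y‖) / 2 := by linarith
  refine continuousAt_of_dominated (bound := fun x => ‖F x‖ * (1 / ((R - ‖y‖) / 2))) ?_ ?_ ?_ ?_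
  · refine Eventually.of_forall fun z => ?_
    exact (hF.1.div (by fun_prop)).aestronglyMeasurable
  · filter_upwards [ball_mem_nhds y hgap] with z hz
    refine ae_of_all _ fun x => ?_
    by_cases hx : x ∈ ball (0:E3) R
    · simp [h0 x hx]
    · rw [mem_ball_zero_iff, not_lt] at hx
      rw [mem_ball, dist_eq_norm] at hz
      have h1 : ‖z‖ ≤ ‖z - y‖ + ‖y‖ := by simpa using norm_add_le (z - y) y
      have h2 := norm_sub_norm_le x z
      rw [norm_sub_rev] at h2
      rw [norm_div, norm_norm, div_eq_mul_one_div]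
      gcongr
      linarith
  · exact hF.integrable.norm.mul_const _
  · refine ae_of_all _ fun x => ?_
    by_cases hx : x ∈ ball (0:E3) R
    · simp only [h0 x hx, zero_div]; exact continuousAt_const
    · have : ‖y - x‖ ≠ 0 := by
        rw [norm_ne_zero_iff, sub_ne_zero]
        rintro rfl
        exact hx (by simpa using hy)
      exact ContinuousAt.div continuousAt_const (by fun_prop) this

/-- The spherical average of the potential. -/
def avg (F : E3 → ℝ) (y : E3) : ℝ := ∫ g, pot F ((gi g).symm y) ∂hm

theorem avg_radial (F : E3 → ℝ) {y y' : E3} (h : ‖y‖ = ‖y'‖) : avg F y = avg F y' := by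
  obtain ⟨T, hT⟩ := exists_isom h
  obtain ⟨g0, hg0⟩ := gi_surj T
  have key := integral_mul_left_eq_self (μ := hm) (fun g => pot F ((gi g).symm y')) g0
  unfold avg
  rw [← key]
  congr 1
  ext g
  rw [gi_symm, gi_symm, mul_inv_rev, gi_mul]
  congr 2
  rw [← hT, ← hg0, ← gi_mul, inv_mul_cancel]
  rfl

theorem joint_meas {F : E3 → ℝ} (hF : Nice F) :
    Measurable fun p : GG × E3 => pot F ((gi p.1).symm p.2) :=
  (pot_measurable hF).comp continuous_gi.measurable

theorem avg_cont {F : E3 → ℝ} (hF : Nice F) {R : ℝ} (h0 : ∀ x ∈ ball (0:E3) R, F x = 0) {y : E3}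
    (hy : ‖y‖ < R) : ContinuousAt (avg F) y := by
  obtain ⟨C, hC⟩ := pot_bdd hF
  refine continuousAt_of_dominated (bound := fun _ => C) ?_ ?_ ?_ ?_
  · refine Eventually.of_forall fun z => ?_
    exact ((joint_meas hF).comp measurable_prodMk_right).aestronglyMeasurable
  · exact Eventually.of_forall fun z => ae_of_all _ fun g => hC _
  · exact integrable_const _
  · refine ae_of_all _ fun g => ?_
    have : ContinuousAt (pot F) ((gi g).symm y) :=
      pot_cont hF h0 (by rwa [LinearIsometryEquiv.norm_map])
    exact ContinuousAt.comp (g := pot F) (f := fun z => (gi g).symm z) this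
      (gi g).symm.continuous.continuousAt

theorem joint_int {F f : E3 → ℝ} (hF : Nice F) (hf : Nice f) :
    Integrable (fun p : GG × E3 => f p.2 * pot F ((gi p.1).symm p.2)) (hm.prod volume) := by
  obtain ⟨C, hC⟩ := pot_bdd hF
  have h1 : Integrable (fun p : GG × E3 => f p.2) (hm.prod volume) := hf.integrable.comp_snd hm
  exact h1.mul_bdd (c := C) (joint_meas hF).aestronglyMeasurable (ae_of_all _ fun p => hC _)

theorem BB_rot {F f : E3 → ℝ} (hF : Nice F) (hf : Nice f) (g : GG) :
    BB F (fun x => f (sig (gi g) 0 x)) = ∫ y, f y * pot F ((gi g).symm y) := by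
  rw [BB_symm hF (nice_sig _ _ hf), BB_eq_pot]
  have key := (sig_mp (gi g) 0).integral_comp (sig_emb (gi g) 0)
    (fun y => f y * pot F ((gi g).symm y))
  rw [← key]
  congr 1
  ext x
  simp [sig_apply]

theorem int_BB_rot {F f : E3 → ℝ} (hF : Nice F) (hf : Nice f) :
    Integrable (fun g => BB F (fun x => f (sig (gi g) 0 x))) hm ∧
    ∫ g, BB F (fun x => f (sig (gi g) 0 x)) ∂hm = ∫ y, f y * avg F y := by
  have hi := joint_int hF hf
  simp only [BB_rot hF hf]
  refine ⟨hi.integral_prod_left, ?_⟩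
  rw [integral_integral_swap (f := fun g y => f y * pot F ((gi g).symm y)) hi]
  congr 1
  ext y
  rw [integral_const_mul, avg]

theorem avg_ball {F : E3 → ℝ} (hF : Nice F) {R r : ℝ} (h0 : ∀ x ∈ ball (0:E3) R, F x = 0)
    (hr : 0 < r) (hrR : r < R) :
    ∫ y in ball (0:E3) r, avg F y = vb * r ^ 3 * ∫ x, F x / ‖x‖ := by
  set f : E3 → ℝ := (ball (0:E3) r).indicator fun _ => 1 with hf
  have nf : Nice f := nice_indicator measurableSet_ball isBounded_ball
  have h1 := (int_BB_rot hF nf).2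
  have hrot : ∀ g : GG, (fun x => f (sig (gi g) 0 x)) = f := by
    intro g
    ext x
    have : sig (gi g) 0 x ∈ ball (0:E3) r ↔ x ∈ ball (0:E3) r := by simp [sig_apply]
    by_cases hx : x ∈ ball (0:E3) r
    · rw [hf, indicator_of_mem hx, indicator_of_mem (this.2 hx)]
    · rw [hf, indicator_of_notMem hx, indicator_of_notMem (fun h => hx (this.1 h))]
  simp only [hrot, integral_const, probReal_univ, one_smul] at h1
  have h2 : ∫ y in ball (0:E3) r, avg F y = ∫ y, f y * avg F y := by
    rw [← integral_indicator measurableSet_ball]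
    congr 1
    ext y
    by_cases hy : y ∈ ball (0:E3) r <;> simp [hf, hy]
  rw [h2, ← h1, BB_eq_pot, ← integral_const_mul]
  congr 1
  ext x
  by_cases hx : x ∈ ball (0:E3) R
  · simp [h0 x hx]
  · have hx' : r < ‖x‖ := by
      rw [mem_ball_zero_iff, not_lt] at hx; linarith
    have : pot f x = vb * r ^ 3 / ‖x‖ := by
      rw [← newton_ball hr hx', ← integral_indicator measurableSet_ball]
      unfold pot
      congr 1
      ext y
      by_cases hy : y ∈ ball (0:E3) r
      · rw [hf, indicator_of_mem hy, indicator_of_mem hy]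
      · rw [hf, indicator_of_notMem hy, indicator_of_notMem hy, zero_div]
    rw [this]
    ring

theorem avg_integrable {F : E3 → ℝ} (hF : Nice F) (r : ℝ) :
    IntegrableOn (avg F) (ball (0:E3) r) := by
  have nf : Nice ((ball (0:E3) r).indicator fun _ => 1) :=
    nice_indicator measurableSet_ball isBounded_ball
  have := (joint_int hF nf).integral_prod_right
  rw [← integrable_indicator_iff measurableSet_ball]
  refine this.congr (ae_of_all _ fun y => ?_)
  simp only [integral_const_mul]
  by_cases hy : y ∈ ball (0:E3) r
  · rw [indicator_of_mem hy, indicator_of_mem hy, one_mul, avg]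
  · rw [indicator_of_notMem hy, indicator_of_notMem hy, zero_mul]

theorem avg_le {F : E3 → ℝ} (hF : Nice F) {R : ℝ} (h0 : ∀ x ∈ ball (0:E3) R, F x = 0)
    {y : E3} (hy : ‖y‖ < R) (hy0 : y ≠ 0) : avg F y ≤ ∫ x, F x / ‖x‖ := by
  set c := ∫ x, F x / ‖x‖ with hc
  by_contra hcon
  push Not at hcon
  have hyp : 0 < ‖y‖ := norm_pos_iff.2 hy0
  set q := (avg F y + c) / 2 with hq
  have hcont : ContinuousAt (fun t : ℝ => avg F ((t / ‖y‖) • y)) ‖y‖ := by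
    have : ContinuousAt (avg F) ((‖y‖ / ‖y‖) • y) := by
      rw [div_self hyp.ne', one_smul]; exact avg_cont hF h0 hy
    exact ContinuousAt.comp (g := avg F) (f := fun t : ℝ => (t / ‖y‖) • y) this (by fun_prop)
  have hev : ∀ᶠ t in 𝓝 ‖y‖, q < avg F ((t / ‖y‖) • y) := by
    apply hcont.eventually (lt_mem_nhds _)
    show q < avg F ((‖y‖ / ‖y‖) • y)
    rw [div_self hyp.ne', one_smul]
    linarith
  obtain ⟨ε, hε, hball⟩ := Metric.eventually_nhds_iff.1 hev
  set r2 := ‖y‖ + min (ε / 2) ((R - ‖y‖) / 2) with hr2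
  have hmin : 0 < min (ε / 2) ((R - ‖y‖) / 2) := lt_min (by linarith) (by linarith)
  have hr2R : r2 < R := by
    have := min_le_right (ε / 2) ((R - ‖y‖) / 2); linarith
  have hr2ε : r2 < ‖y‖ + ε := by
    have := min_le_left (ε / 2) ((R - ‖y‖) / 2); linarith
  have hsub : ball (0:E3) ‖y‖ ⊆ ball 0 r2 := ball_subset_ball (by linarith)
  have hd : ∫ z in ball (0:E3) r2 \ ball 0 ‖y‖, avg F z = vb * (r2 ^ 3 - ‖y‖ ^ 3) * c := by
    rw [setIntegral_sdiff measurableSet_ball (avg_integrable hF r2) hsub,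
      avg_ball hF h0 (by linarith) hr2R, avg_ball hF h0 hyp hy]
    ring
  have hvS : (volume : Measure E3).real (ball (0:E3) r2 \ ball 0 ‖y‖) =
      vb * (r2 ^ 3 - ‖y‖ ^ 3) := by
    rw [measureReal_sdiff hsub measurableSet_ball measure_ball_lt_top.ne]
    unfold Measure.real
    have := vb_pos
    rw [volume_ball_eq _ (by linarith), volume_ball_eq _ hyp.le,
      ENNReal.toReal_ofReal (by positivity), ENNReal.toReal_ofReal (by positivity)]
    ring
  have hge : q * (volume : Measure E3).real (ball (0:E3) r2 \ ball 0 ‖y‖) ≤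
      ∫ z in ball (0:E3) r2 \ ball 0 ‖y‖, avg F z := by
    refine setIntegral_ge_of_const_le_real (measurableSet_ball.diff measurableSet_ball)
      (measure_ne_top_of_subset sdiff_subset measure_ball_lt_top.ne) ?_
      ((avg_integrable hF r2).mono_set sdiff_subset)
    intro z hz
    have hz1 : ‖z‖ < r2 := by simpa using hz.1
    have hz2 : ‖y‖ ≤ ‖z‖ := by simpa using hz.2
    have := hball (y := ‖z‖) (by rw [Real.dist_eq, abs_of_nonneg (by linarith)]; linarith)
    refine this.le.trans (le_of_eq (avg_radial F ?_))
    rw [norm_smul, norm_div, norm_norm, norm_norm, div_mul_cancel₀ _ hyp.ne']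
  rw [hd, hvS] at hge
  have hpos : 0 < vb * (r2 ^ 3 - ‖y‖ ^ 3) := by
    have : ‖y‖ ^ 3 < r2 ^ 3 := by gcongr; linarith
    exact mul_pos vb_pos (by linarith)
  have : q ≤ c := by
    by_contra hh
    push Not at hh
    nlinarith
  linarith

theorem avg_neg (F : E3 → ℝ) (y : E3) : avg (fun x => (-1) * F x) y = - avg F y := by
  unfold avg pot
  rw [← integral_neg]
  congr 1
  ext g
  rw [← integral_neg]
  congr 1
  ext x
  ring

theorem avg_eq {F : E3 → ℝ} (hF : Nice F) {R : ℝ} (h0 : ∀ x ∈ ball (0:E3) R, F x = 0)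
    {y : E3} (hy : ‖y‖ < R) (hy0 : y ≠ 0) : avg F y = ∫ x, F x / ‖x‖ := by
  refine le_antisymm (avg_le hF h0 hy hy0) ?_
  have := avg_le (hF.const_mul (-1)) (fun x hx => by rw [h0 x hx, mul_zero]) hy hy0
  rw [avg_neg] at this
  have e : ∫ x, (-1) * F x / ‖x‖ = - ∫ x, F x / ‖x‖ := by
    rw [← integral_neg]
    congr 1
    ext x
    ring
  linarith

theorem exists_rot {F f : E3 → ℝ} (hF : Nice F) (hf : Nice f) {R : ℝ}
    (h0 : ∀ x ∈ ball (0:E3) R, F x = 0) (hf0 : ∀ x, x ∉ ball (0:E3) R → f x = 0)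
    (hn : ∫ x, f x = 0) : ∃ T : E3 ≃ₗᵢ[ℝ] E3, BB F (fun x => f (sig T 0 x)) ≤ 0 := by
  obtain ⟨h1, h2⟩ := int_BB_rot hF hf
  obtain ⟨g, hg⟩ := exists_le_integral h1
  refine ⟨gi g, hg.trans ?_⟩
  rw [h2]
  have : ∫ y, f y * avg F y = ∫ y, (∫ x, F x / ‖x‖) * f y := by
    refine integral_congr_ae ?_
    have hnull : ∀ᵐ y : E3, y ≠ 0 := by
      have := measure_eq_zero_iff_ae_notMem.1 (measure_singleton (μ := volume) (0:E3))
      simpa using this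
    filter_upwards [hnull] with y hy
    by_cases hyR : y ∈ ball (0:E3) R
    · rw [avg_eq hF h0 (by simpa using hyR) hy, mul_comm]
    · rw [hf0 y hyR]; ring
  rw [this, integral_const_mul, hn, mul_zero]

/-- Grid point. -/
def gpt (s : ℝ) (k : Fin 3 → ℤ) : E3 := WithLp.toLp 2 fun i => s * (k i : ℝ)

theorem gpt_apply (s : ℝ) (k : Fin 3 → ℤ) (i : Fin 3) : gpt s k i = s * (k i : ℝ) := rfl

/-- Grid cube. -/
def gcube (s : ℝ) (k : Fin 3 → ℤ) : Set E3 := cube (gpt s k) s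

theorem mem_gcube {s : ℝ} (hs : 0 < s) {k : Fin 3 → ℤ} {x : E3} :
    x ∈ gcube s k ↔ ∀ i, k i = ⌊x i / s⌋ := by
  unfold gcube cube
  simp only [mem_ofPred_eq, gpt_apply, mem_Ico]
  refine forall_congr' fun i => ?_
  rw [eq_comm, Int.floor_eq_iff, le_div_iff₀ hs, div_lt_iff₀ hs]
  constructor <;> rintro ⟨h1, h2⟩ <;> constructor <;> linarith

theorem gcube_cover {s : ℝ} (hs : 0 < s) (x : E3) : x ∈ gcube s fun i => ⌊x i / s⌋ :=
  (mem_gcube hs).2 fun _ => rfl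

theorem gcube_disj {s : ℝ} (hs : 0 < s) :
    Pairwise fun k l : Fin 3 → ℤ => Disjoint (gcube s k) (gcube s l) := by
  intro k l hkl
  rw [Set.disjoint_left]
  intro x hx hx'
  apply hkl
  ext i
  rw [(mem_gcube hs).1 hx i, (mem_gcube hs).1 hx' i]

theorem gcube_count {s : ℝ} (hs : 0 < s) (K : Finset (Fin 3 → ℤ)) {S : Set E3}
    (h : ∀ k ∈ K, gcube s k ⊆ S) (hS : volume S ≠ ⊤) : (K.card : ℝ) * s ^ 3 ≤ vol S := by
  have h1 : volume (⋃ k ∈ K, gcube s k) = K.card * ENNReal.ofReal (s ^ 3) := by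
    rw [measure_biUnion_finset]
    · simp [gcube, volume_cube _ s hs.le]
    · intro a _ b _ hab
      exact gcube_disj hs hab
    · exact fun k _ => measurableSet_cube _ _
  have h2 : volume (⋃ k ∈ K, gcube s k) ≤ volume S := measure_mono (iUnion₂_subset h)
  rw [h1] at h2
  have := ENNReal.toReal_mono hS h2
  rwa [ENNReal.toReal_mul, ENNReal.toReal_natCast, ENNReal.toReal_ofReal (by positivity)] at this

theorem Fill.cube_translate {ρ s c : ℝ} {a : E3} (h : Fill ρ (cube a s) c) (b : E3) :
    Fill ρ (cube b s) c := by
  have := h.sig (LinearIsometryEquiv.refl ℝ E3) (a - b)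
  convert this using 1
  ext x
  simp only [cube, mem_ofPred_eq, mem_preimage, sig_apply, LinearIsometryEquiv.coe_refl, id,
    mem_Ico, PiLp.add_apply, PiLp.sub_apply]
  refine forall_congr' fun i => ?_
  constructor <;> rintro ⟨h1, h2⟩ <;> constructor <;> linarith

theorem cellC_nonneg {s k : ℝ} (hs : 0 ≤ s) : 0 ≤ cellC s k := by
  unfold cellC
  have := vb_pos
  have := potC_nonneg
  positivity

/-- Boundary cost. -/
def kap (s : ℝ) : ℝ := 1 + 2 * s / s ^ 3 * cellC s (2 * s)

theorem kap_nonneg {s : ℝ} (hs : 0 < s) : 0 ≤ kap s := by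
  unfold kap
  have := cellC_nonneg (k := 2 * s) hs.le
  positivity

theorem region {ρ : ℝ} (h0 : 0 ≤ ρ) (h1 : ρ ≤ 1) {s e m : ℝ} (hs : 0 < s) (he : 0 ≤ e)
    (hc : Fill ρ (cube 0 s) (e * s ^ 3)) {U : Set E3} (mU : MeasurableSet U) (bU : IsBounded U)
    (hU : Reg U m (2 * s)) : Fill ρ U (e * vol U + kap s * m) := by
  classical
  obtain ⟨M, hM⟩ := bU.subset_ball (0:E3)
  set N : ℤ := ⌈M / s⌉ + 1 with hN
  set K : Finset (Fin 3 → ℤ) := Fintype.piFinset fun _ => Finset.Icc (-N) N with hK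
  have hKU : ∀ x ∈ U, (fun i => ⌊x i / s⌋) ∈ K := by
    intro x hx
    have hxM := hM hx
    rw [mem_ball_zero_iff] at hxM
    rw [hK, Fintype.mem_piFinset]
    intro i
    have hi := (abs_coord_le x i).trans hxM.le
    rw [abs_le] at hi
    have h3 := Int.le_ceil (M / s)
    have h4 : x i / s ≤ M / s := by gcongr; exact hi.2
    have h5 : -(M / s) ≤ x i / s := by rw [← neg_div]; gcongr; exact hi.1
    rw [Finset.mem_Icc]
    constructor
    · rw [Int.le_floor, hN]; push_cast; linarith
    · have := Int.floor_le (x i / s)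
      have : ((⌊x i / s⌋ : ℤ) : ℝ) ≤ (N : ℝ) := by rw [hN]; push_cast; linarith
      exact_mod_cast this
  set K1 := K.filter fun k => gcube s k ⊆ U with hK1
  set K2 := K.filter fun k => ¬ gcube s k ⊆ U ∧ (U ∩ gcube s k).Nonempty with hK2
  have hcov : U = (⋃ k ∈ K1, gcube s k) ∪ ⋃ k ∈ K2, U ∩ gcube s k := by
    ext x
    constructor
    · intro hx
      have hxc := gcube_cover hs x
      by_cases hsub : gcube s (fun i => ⌊x i / s⌋) ⊆ U
      · left
        exact mem_biUnion (Finset.mem_filter.2 ⟨hKU x hx, hsub⟩) hxc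
      · right
        exact mem_biUnion (Finset.mem_filter.2 ⟨hKU x hx, hsub, ⟨x, hx, hxc⟩⟩)
          (show x ∈ U ∩ _ from ⟨hx, hxc⟩)
    · rintro (hx | hx)
      · obtain ⟨k, hk, hxk⟩ := mem_iUnion₂.1 hx
        exact (Finset.mem_filter.1 hk).2 hxk
      · obtain ⟨k, hk, hxk⟩ := mem_iUnion₂.1 hx
        exact hxk.1
  have mg : ∀ k, MeasurableSet (gcube s k) := fun k => measurableSet_cube _ _
  have bg : ∀ k, IsBounded (gcube s k) := fun k => cube_bounded _ _
  have mUg : ∀ k, MeasurableSet (U ∩ gcube s k) := fun k => mU.inter (mg k)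
  have bUg : ∀ k, IsBounded (U ∩ gcube s k) := fun k => bU.subset inter_subset_left
  have F1 : Fill ρ (⋃ k ∈ K1, gcube s k) (∑ k ∈ K1, e * s ^ 3) :=
    Fill.biUnion K1 (fun k _ => hc.cube_translate _) (gcube_disj hs) mg bg
  have F2 : FillU ρ U (⋃ k ∈ K2, U ∩ gcube s k) (2 * s) (∑ k ∈ K2, cellC s (2 * s)) :=
    FillU.biUnion K2 mU (fun k _ => cell_fill h0 h1 mU _ hs (by positivity))
      (fun k l hkl => (gcube_disj hs hkl).mono inter_subset_right inter_subset_right) mUg bUg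
  have b1 : IsBounded (⋃ k ∈ K1, gcube s k) := (isBounded_biUnion_finset K1).2 fun i _ => bg i
  have b2 : IsBounded (⋃ k ∈ K2, U ∩ gcube s k) :=
    (isBounded_biUnion_finset K2).2 fun i _ => bUg i
  have F3 := F2.fill hU (by positivity) mU b2
  have hdis : Disjoint (⋃ k ∈ K1, gcube s k) (⋃ k ∈ K2, U ∩ gcube s k) := by
    simp only [disjoint_iUnion_left, disjoint_iUnion_right]
    intro l hl k hk
    refine (gcube_disj hs ?_).mono_right inter_subset_right
    rintro rfl
    exact (Finset.mem_filter.1 hl).2.1 (Finset.mem_filter.1 hk).2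
  have F4 := F1.union F3 hdis (Finset.measurableSet_biUnion K1 fun i _ => mg i)
    (Finset.measurableSet_biUnion K2 fun i _ => mUg i) b1 b2
  rw [← hcov] at F4
  refine F4.mono ?_
  rw [Finset.sum_const, Finset.sum_const, nsmul_eq_mul, nsmul_eq_mul]
  have c1 : (K1.card : ℝ) * s ^ 3 ≤ vol U :=
    gcube_count hs K1 (fun k hk => (Finset.mem_filter.1 hk).2) bU.measure_lt_top.ne
  have hth := hU.2 (2 * s) (by positivity) le_rfl
  have hthf : volume (thickening (2 * s) (frontier U)) ≠ ⊤ :=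
    (hth.trans_lt ENNReal.ofReal_lt_top).ne
  have c2 : (K2.card : ℝ) * s ^ 3 ≤ vol (thickening (2 * s) (frontier U)) := by
    refine gcube_count hs K2 (fun k hk p hp => ?_) hthf
    obtain ⟨_, hk1, w, hwU, hwk⟩ := Finset.mem_filter.1 hk
    obtain ⟨v, hvk, hvU⟩ := Set.not_subset.1 hk1
    rw [mem_thickening_iff]
    by_cases hpU : p ∈ U
    · obtain ⟨z, hz, hzs⟩ := exists_frontier_segment hpU hvU
      exact ⟨z, hz, (dist_segment_le hzs).trans_lt (cube_dist hs hp hvk)⟩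
    · obtain ⟨z, hz, hzs⟩ := exists_frontier_segment hwU hpU
      rw [segment_symm] at hzs
      exact ⟨z, hz, (dist_segment_le hzs).trans_lt (cube_dist hs hp hwk)⟩
  have c3 : vol (thickening (2 * s) (frontier U)) ≤ m * (2 * s) := by
    have := ENNReal.toReal_mono ENNReal.ofReal_ne_top hth
    rwa [ENNReal.toReal_ofReal (mul_nonneg hU.1 (by positivity))] at this
  have hcc := cellC_nonneg (k := 2 * s) hs.le
  have d1 : (K1.card : ℝ) * (e * s ^ 3) ≤ e * vol U := by nlinarith
  have d2 : (K2.card : ℝ) ≤ m * (2 * s) / s ^ 3 := by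
    rw [le_div_iff₀ (by positivity)]; linarith
  have d3 : (K2.card : ℝ) * cellC s (2 * s) ≤ m * (2 * s) / s ^ 3 * cellC s (2 * s) := by gcongr
  have d4 : kap s * m = m + m * (2 * s) / s ^ 3 * cellC s (2 * s) := by unfold kap; ring
  linarith

/-- Existence of a competitor, without external charge. -/
def WFill (ρ : ℝ) (P : Set E3) (c : ℝ) : Prop :=
  ∃ Ω, MeasurableSet Ω ∧ Ω ⊆ P ∧ HasFinPer Ω ∧ vol Ω = ρ * vol P ∧ ldEnergy P ρ Ω ≤ c

theorem Fill.wfill {ρ : ℝ} {P : Set E3} {c : ℝ} (h : Fill ρ P c) : WFill ρ P c := by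
  obtain ⟨Ω, h1, h2, h3, h4, h5⟩ := h (fun _ => 0) nice_zero fun _ _ => rfl
  refine ⟨Ω, h1, h2, h3, h4, ?_⟩
  rw [BB_zero_left, add_zero] at h5
  exact h5

theorem ldEnergy_nonneg {ρ : ℝ} {P Ω : Set E3} (mP : MeasurableSet P) (bP : IsBounded P)
    (h1 : MeasurableSet Ω) (h2 : Ω ⊆ P) (h3 : HasFinPer Ω) : 0 ≤ ldEnergy P ρ Ω := by
  rw [ldEnergy_eq]
  have := per_nonneg h3
  have := BB_self_nonneg (nice_chg ρ mP h1 h2 bP)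
  linarith

theorem WFill.nonneg {ρ : ℝ} {P : Set E3} {c : ℝ} (h : WFill ρ P c) (mP : MeasurableSet P)
    (bP : IsBounded P) : 0 ≤ c := by
  obtain ⟨Ω, h1, h2, h3, h4, h5⟩ := h
  exact (ldEnergy_nonneg mP bP h1 h2 h3).trans h5

theorem WFill.EE_le {ρ : ℝ} {P : Set E3} {c : ℝ} (h : WFill ρ P c) (mP : MeasurableSet P)
    (bP : IsBounded P) : EE P ρ ≤ c := by
  obtain ⟨Ω, h1, h2, h3, h4, h5⟩ := h
  refine le_trans (csInf_le ⟨0, ?_⟩ ⟨Ω, h1, h2, h3, h4, rfl⟩) h5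
  rintro t ⟨Ω', h1', h2', h3', h4', rfl⟩
  exact ldEnergy_nonneg mP bP h1' h2' h3'

theorem WFill.near {ρ : ℝ} {P : Set E3} {c : ℝ} (h : WFill ρ P c) {δ : ℝ} (hδ : 0 < δ) :
    WFill ρ P (EE P ρ + δ) := by
  obtain ⟨Ω, h1, h2, h3, h4, h5⟩ := h
  obtain ⟨t, ⟨Ω', h1', h2', h3', h4', rfl⟩, ht⟩ := exists_lt_of_csInf_lt
    (s := {t : ℝ | ∃ Ω : Set E3, MeasurableSet Ω ∧ Ω ⊆ P ∧ HasFinPer Ω ∧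
      vol Ω = ρ * vol P ∧ t = ldEnergy P ρ Ω}) ⟨_, Ω, h1, h2, h3, h4, rfl⟩
    (show sInf _ < EE P ρ + δ from by unfold EE; linarith)
  exact ⟨Ω', h1', h2', h3', h4', ht.le⟩

theorem WFill.union {ρ : ℝ} {P P' : Set E3} {c c' : ℝ} (h : WFill ρ P c) (h' : Fill ρ P' c')
    (hd : Disjoint P P') (mP : MeasurableSet P) (mP' : MeasurableSet P') (bP : IsBounded P)
    (bP' : IsBounded P') : WFill ρ (P ∪ P') (c + c') := by
  obtain ⟨Ω, h1, h2, h3, h4, h5⟩ := h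
  have nf := nice_chg ρ mP h1 h2 bP
  obtain ⟨Ω', h1', h2', h3', h4', h5'⟩ := h' (chg ρ P Ω) nf fun x hx =>
    chg_zero h2 (fun hx' => hd.le_bot ⟨hx', hx⟩)
  have nf' := nice_chg ρ mP' h1' h2' bP'
  have hdΩ : Disjoint Ω Ω' := hd.mono h2 h2'
  have hper := perCand_union_le h1' hdΩ h3 h3'
  refine ⟨Ω ∪ Ω', h1.union h1', union_subset_union h2 h2', ⟨_, hper⟩, ?_, ?_⟩
  · rw [vol_union h1' hdΩ (bP.subset h2) (bP'.subset h2'), vol_union mP' hd bP bP', h4, h4']; ring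
  · rw [ldEnergy_eq] at h5 ⊢
    have := energy_union nice_zero nf nf'
    simp only [BB_zero_left, zero_add, add_zero] at this
    rw [chg_union hd h2 h2', this]
    linarith [per_le_of hper]

theorem chg_integral {ρ : ℝ} {P Ω : Set E3} (mP : MeasurableSet P) (bP : IsBounded P)
    (h1 : MeasurableSet Ω) (h2 : Ω ⊆ P) : ∫ x, chg ρ P Ω x = vol Ω - ρ * vol P := by
  unfold chg
  have i1 : Integrable (Ω.indicator fun _ => (1:ℝ)) := (nice_indicator h1 (bP.subset h2)).integrable
  have i2 : Integrable (P.indicator fun _ => (1:ℝ)) := (nice_indicator mP bP).integrable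
  rw [integral_sub i1 (i2.const_mul ρ), integral_const_mul, integral_indicator h1,
    integral_indicator mP]
  simp [vol, Measure.real]

theorem WFill.ball {ρ R c : ℝ} (h : WFill ρ (ball (0:E3) R) c) : Fill ρ (ball (0:E3) R) c := by
  obtain ⟨Ω, h1, h2, h3, h4, h5⟩ := h
  intro F hF hF0
  have nf := nice_chg ρ measurableSet_ball h1 h2 isBounded_ball
  obtain ⟨T, hT⟩ := exists_rot hF nf hF0 (fun x hx => chg_zero h2 hx)
    (by rw [chg_integral measurableSet_ball isBounded_ball h1 h2, h4, sub_self])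
  have hb : sig T 0 ⁻¹' (Metric.ball (0:E3) R) = Metric.ball 0 R := by
    ext x; simp [sig_apply]
  refine ⟨sig T 0 ⁻¹' Ω, (sig T 0).continuous.measurable h1, ?_, (finPer_sig T 0 Ω).2 h3, ?_, ?_⟩
  · rw [← hb]; exact preimage_mono h2
  · rw [vol_sig, h4]
  · have e : chg ρ (Metric.ball 0 R) (sig T 0 ⁻¹' Ω) =
        fun x => chg ρ (Metric.ball 0 R) Ω (sig T 0 x) := by
      rw [← chg_sig, hb]
    rw [e, per_sig, BB_sig]
    rw [ldEnergy_eq] at h5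
    linarith

/-- The limiting energy density. -/
def gg (ρ : ℝ) : ℝ := sInf {e : ℝ | ∃ s : ℝ, 0 < s ∧ Fill ρ (cube 0 s) (e * s ^ 3)}

theorem gset_nonneg {ρ e s : ℝ} (hs : 0 < s) (h : Fill ρ (cube 0 s) (e * s ^ 3)) : 0 ≤ e := by
  have := h.wfill.nonneg (measurableSet_cube _ _) (cube_bounded _ _)
  exact nonneg_of_mul_nonneg_left this (by positivity)

theorem gg_le {ρ c s : ℝ} {a : E3} (hs : 0 < s) (h : Fill ρ (cube a s) c) :
    gg ρ * s ^ 3 ≤ c := by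
  have h' : Fill ρ (cube 0 s) (c / s ^ 3 * s ^ 3) := by
    rw [div_mul_cancel₀ _ (by positivity)]; exact h.cube_translate 0
  have : gg ρ ≤ c / s ^ 3 := by
    refine csInf_le ⟨0, ?_⟩ ⟨s, hs, h'⟩
    rintro e ⟨s', hs', he⟩
    exact gset_nonneg hs' he
  rwa [le_div_iff₀ (by positivity)] at this

theorem exists_good {ρ : ℝ} (h0 : 0 ≤ ρ) (h1 : ρ ≤ 1) {δ : ℝ} (hδ : 0 < δ) :
    ∃ e s : ℝ, 0 < s ∧ 0 ≤ e ∧ gg ρ ≤ e ∧ e < gg ρ + δ ∧ Fill ρ (cube 0 s) (e * s ^ 3) := by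
  have hne : {e : ℝ | ∃ s : ℝ, 0 < s ∧ Fill ρ (cube 0 s) (e * s ^ 3)}.Nonempty := by
    have h := (cell_fill h0 h1 (measurableSet_cube 0 1) 0 one_pos one_pos).fill
      (reg_cube 0 zero_le_one) one_pos (measurableSet_cube 0 1)
      ((cube_bounded 0 1).subset inter_subset_left)
    rw [inter_self] at h
    refine ⟨64 * (1 + 1) ^ 2 + cellC 1 1, 1, one_pos, ?_⟩
    rw [one_pow, mul_one]
    exact h
  obtain ⟨e, ⟨s, hs, he⟩, hlt⟩ := exists_lt_of_csInf_lt hne (show sInf _ < gg ρ + δ from by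
    unfold gg; linarith)
  refine ⟨e, s, hs, gset_nonneg hs he, ?_, hlt, he⟩
  have := gg_le hs he
  exact le_of_mul_le_mul_right this (by positivity)

theorem EE_upper {ρ : ℝ} (h0 : 0 ≤ ρ) (h1 : ρ ≤ 1) {s e m : ℝ} (hs : 0 < s) (he : 0 ≤ e)
    (hc : Fill ρ (cube 0 s) (e * s ^ 3)) {U : Set E3} (mU : MeasurableSet U) (bU : IsBounded U)
    (hU : Reg U m (2 * s)) : EE U ρ ≤ e * vol U + kap s * m :=
  (region h0 h1 hs he hc mU bU hU).wfill.EE_le mU bU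

theorem EE_lower {ρ : ℝ} (h0 : 0 ≤ ρ) (h1 : ρ ≤ 1) {s e m ℓ : ℝ} (hs : 0 < s) (he : 0 ≤ e)
    (hc : Fill ρ (cube 0 s) (e * s ^ 3)) {U : Set E3} (mU : MeasurableSet U)
    (hℓ : 0 < ℓ) (hUb : U ⊆ ball 0 ℓ) (hU : Reg U m (2 * s)) :
    gg ρ * (2 * ℓ) ^ 3 ≤ EE U ρ + 2 * ℓ ^ 2 + e * ((2 * ℓ) ^ 3 - vol U) +
      kap s * (8 * vb * (ℓ + 2 * s) ^ 2 + m) +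
      kap s * (64 * (2 * ℓ + 2 * s) ^ 2 + 8 * vb * (ℓ + 2 * s) ^ 2) := by
  have bU : IsBounded U := isBounded_ball.subset hUb
  have w1 := (region h0 h1 hs he hc mU bU hU).wfill.near (δ := ℓ ^ 2) (by positivity)
  have mB : MeasurableSet (ball (0:E3) ℓ) := measurableSet_ball
  have bB : IsBounded (ball (0:E3) ℓ) := isBounded_ball
  have f2 := region h0 h1 hs he hc (mB.diff mU) (bB.subset sdiff_subset)
    ((reg_ball 0 hℓ.le).diff hU)
  have w3 := w1.union f2 disjoint_sdiff_right mU (mB.diff mU) bU (bB.subset sdiff_subset)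
  have v3 := vol_union (mB.diff mU) disjoint_sdiff_right bU (bB.subset sdiff_subset)
  rw [union_sdiff_cancel hUb] at w3 v3
  have w4 := w3.EE_le mB bB
  have f5 := (w3.near (δ := ℓ ^ 2) (by positivity)).ball
  set a : E3 := WithLp.toLp 2 fun _ => -ℓ with ha
  have hsub : ball (0:E3) ℓ ⊆ cube a (2 * ℓ) := by
    intro x hx i
    rw [mem_ball_zero_iff] at hx
    have := abs_lt.1 ((abs_coord_le x i).trans_lt hx)
    have hai : a i = -ℓ := rfl
    rw [hai]
    constructor <;> linarith [this.1, this.2]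
  have mQ := measurableSet_cube a (2 * ℓ)
  have bQ := cube_bounded a (2 * ℓ)
  have f6 := region h0 h1 hs he hc (mQ.diff mB) (bQ.subset sdiff_subset)
    ((reg_cube a (by positivity)).diff (reg_ball 0 hℓ.le))
  have f7 := f5.union f6 disjoint_sdiff_right mB (mQ.diff mB) bB (bQ.subset sdiff_subset)
  have v7 := vol_union (mQ.diff mB) disjoint_sdiff_right bB (bQ.subset sdiff_subset)
  rw [union_sdiff_cancel hsub] at f7 v7
  rw [vol_cube a _ (by positivity)] at v7
  have := gg_le (by positivity) f7
  have ev : e * vol (ball 0 ℓ \ U) + e * vol (cube a (2 * ℓ) \ ball 0 ℓ) =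
      e * ((2 * ℓ) ^ 3 - vol U) := by
    rw [v7, v3]; ring
  linarith

theorem reg_of_fisher {C ℓ : ℝ} {U : Set E3} (hC : 0 < C) (bU : IsBounded U)
    (h : FisherCond C ℓ U) {k : ℝ} (hk : k ≤ ℓ) : Reg U (C * ℓ ^ 2) k := by
  refine ⟨by positivity, fun t ht htk => ?_⟩
  have hb : IsBounded (thickening t (frontier U)) :=
    (bU.closure.subset frontier_subset_closure).thickening
  have := h t ht (htk.trans hk)
  rw [add_ball_zero] at this
  rw [← ENNReal.ofReal_toReal hb.measure_lt_top.ne]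
  exact ENNReal.ofReal_le_ofReal this

/-- **Thermodynamic limit.** For every `0 ≤ ρ ≤ 1`, there is a number `eρ` such that for every
sequence of `(r,L)`-Lipschitz bounded open sets `Λ n` with `ball 0 (ℓ n / C) ⊆ Λ n ⊆ ball 0 (ℓ n)`,
`ℓ n → ∞`, satisfying the Fisher regularity condition, the energy per unit volume
`E_{Λ n}(ρ)/|Λ n|` converges to `eρ`; in particular the limit exists and does not depend on the
sequence nor on the constants `r, L, C`. -/
theorem thermodynamic_limit_exists (ρ : ℝ) (hρ0 : 0 ≤ ρ) (hρ1 : ρ ≤ 1) :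
    ∃ eρ : ℝ, ∀ (r L C : ℝ) (Λs : ℕ → Set E3) (ℓ : ℕ → ℝ),
      0 < r → 0 < L → 0 < C → IsAdmissibleSeq r L C Λs ℓ →
      Tendsto (fun n => EE (Λs n) ρ / vol (Λs n)) atTop (𝓝 eρ) := by
  refine ⟨gg ρ, fun r L C Λs ℓ _ _ hC hadm => ?_⟩
  obtain ⟨hℓ, hΛ⟩ := hadm
  have hvb := vb_pos
  rw [Metric.tendsto_atTop']
  intro ε hε
  set D : ℝ := C ^ 3 / vb with hD
  have hDp : 0 < D := by positivity
  set δ : ℝ := min (ε / 2) (ε / (16 * D)) with hδ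
  have hδp : 0 < δ := lt_min (by positivity) (by positivity)
  have hδ1 : δ ≤ ε / 2 := min_le_left _ _
  have hδ2 : 8 * δ * D ≤ ε / 2 := by
    have : δ ≤ ε / (16 * D) := min_le_right _ _
    rw [le_div_iff₀ (by positivity)] at this
    linarith
  obtain ⟨e, s, hs, he, hge, heg, hF⟩ := exists_good hρ0 hρ1 hδp
  have hkap := kap_nonneg hs
  set K : ℝ := 2 + kap s * (C + 576 + 64 * vb) with hK
  have hKp : 0 < K := by positivity
  have hev : ∀ᶠ n in atTop, max (2 * s) (2 * (K * D) / ε + 1) ≤ ℓ n := hℓ.eventually_ge_atTop _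
  obtain ⟨N, hN⟩ := eventually_atTop.1 hev
  refine ⟨N, fun n hn => ?_⟩
  have hb := hN n hn.le
  obtain ⟨hopen, hbdd, _, hin, hout, hfish⟩ := hΛ n
  set l := ℓ n with hl
  set U := Λs n with hUdef
  have hl1 : 2 * s ≤ l := (le_max_left _ _).trans hb
  have hl2 : 2 * (K * D) / ε + 1 ≤ l := (le_max_right _ _).trans hb
  have hlp : 0 < l := by linarith
  have hKD : K * D < ε / 2 * l := by
    have : 2 * (K * D) / ε < l := by linarith
    rw [div_lt_iff₀ hε] at this
    linarith
  have hreg : Reg U (C * l ^ 2) (2 * s) := reg_of_fisher hC hbdd hfish hl1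
  have hup := EE_upper hρ0 hρ1 hs he hF hopen.measurableSet hbdd hreg
  have hlo := EE_lower hρ0 hρ1 hs he hF hopen.measurableSet hlp hout hreg
  have hvol : l ^ 3 ≤ D * vol U := by
    have h1 : vol (ball (0:E3) (l / C)) ≤ vol U :=
      ENNReal.toReal_mono hbdd.measure_lt_top.ne (measure_mono hin)
    have h2 : vol (ball (0:E3) (l / C)) = vb * (l / C) ^ 3 := by
      unfold vol
      rw [volume_ball_eq _ (by positivity), ENNReal.toReal_ofReal (by positivity)]
    have h3 : D * (vb * (l / C) ^ 3) = l ^ 3 := by rw [hD]; field_simp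
    rw [h2] at h1
    calc l ^ 3 = D * (vb * (l / C) ^ 3) := h3.symm
      _ ≤ D * vol U := by gcongr
  have hvp : 0 < vol U := by
    have : 0 < D * vol U := lt_of_lt_of_le (by positivity) hvol
    exact (mul_pos_iff_of_pos_left hDp).1 this
  -- error term
  have herr : K * l ^ 2 < ε / 2 * vol U := by
    have h1 : K * l ^ 2 * D < ε / 2 * l ^ 3 := by
      have : 0 < l ^ 2 := by positivity
      nlinarith
    have h2 : ε / 2 * l ^ 3 ≤ ε / 2 * (D * vol U) := by gcongr
    have h3 : K * l ^ 2 * D < (ε / 2 * vol U) * D := by linarith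
    exact lt_of_mul_lt_mul_right h3 hDp.le
  have hup2 : EE U ρ < (gg ρ + ε) * vol U := by
    have h1 : e * vol U ≤ (gg ρ + ε / 2) * vol U := by gcongr; linarith
    have h2 : kap s * (C * l ^ 2) ≤ K * l ^ 2 := by
      have : 0 ≤ kap s * (576 + 64 * vb) * l ^ 2 := by positivity
      have : 0 ≤ l ^ 2 := by positivity
      rw [hK]
      linarith
    linarith
  have hlo2 : (gg ρ - ε) * vol U < EE U ρ := by
    have hvle : 0 ≤ vol U := hvp.le
    have h1 : (e - gg ρ) * ((2 * l) ^ 3 - vol U) ≤ ε / 2 * vol U := by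
      have a1 : (e - gg ρ) * ((2 * l) ^ 3 - vol U) ≤ (e - gg ρ) * (2 * l) ^ 3 := by
        have : 0 ≤ e - gg ρ := by linarith
        nlinarith
      have a2 : (e - gg ρ) * (2 * l) ^ 3 ≤ δ * (2 * l) ^ 3 := by gcongr; linarith
      have a3 : δ * (2 * l) ^ 3 = 8 * δ * l ^ 3 := by ring
      have a4 : 8 * δ * l ^ 3 ≤ 8 * δ * (D * vol U) := by gcongr
      have a5 : 8 * δ * D * vol U ≤ ε / 2 * vol U := by gcongr
      linarith
    have h2 : 2 * l ^ 2 + kap s * (8 * vb * (l + 2 * s) ^ 2 + C * l ^ 2) +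
        kap s * (64 * (2 * l + 2 * s) ^ 2 + 8 * vb * (l + 2 * s) ^ 2) ≤ K * l ^ 2 := by
      have b1 : (l + 2 * s) ^ 2 ≤ (2 * l) ^ 2 := by gcongr; linarith
      have b2 : (2 * l + 2 * s) ^ 2 ≤ (3 * l) ^ 2 := by gcongr; linarith
      calc _ ≤ 2 * l ^ 2 + kap s * (8 * vb * (2 * l) ^ 2 + C * l ^ 2) +
            kap s * (64 * (3 * l) ^ 2 + 8 * vb * (2 * l) ^ 2) := by gcongr
        _ = K * l ^ 2 := by rw [hK]; ring
    linarith
  rw [Real.dist_eq, abs_lt]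
  constructor
  · rw [neg_lt_sub_iff_lt_add, ← sub_lt_iff_lt_add', lt_div_iff₀ hvp]
    exact hlo2
  · rw [sub_lt_iff_lt_add', div_lt_iff₀ hvp]
    exact hup2

end
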